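/- arXiv:2604.26451 — 14 statements merged into one kernel-verified Lean document; each statement's English description precedes it below -/
import Mathlib

section
/- For every vertex v ∈ V and indices 0 ≤ i ≤ j ≤ k−1, if the pivot p_i(v) belongs to A_j, then p_i(v) = p_j(v). -/
/-- If the pivot `p_i(v)` belongs to `A_j` for `i ≤ j ≤ k-1`,
then `p_i(v) = p_j(v)`. -/
theorem pivot_consistent
    {V : Type*} [MetricSpace V] [Fintype V]
    (k : ℕ) (hk : 2 ≤ k)
    -- the nested sets `V = A_0 ⊇ A_1 ⊇ ⋯ ⊇ A_{k-1}`, `A_k = ∅`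
    (A : ℕ → Set V)
    (hA0 : A 0 = Set.univ)
    (hAanti : ∀ i < k, A (i + 1) ⊆ A i)
    (hAne : (A (k - 1)).Nonempty)
    (hAk : A k = ∅)
    -- the pivots `p_i(v)`, chosen with consistent tie-breaking
    (p : V → ℕ → V)
    (hpmem : ∀ v : V, ∀ i ≤ k - 1, p v i ∈ A i)
    (hpmin : ∀ v : V, ∀ i ≤ k - 1, ∀ w ∈ A i, dist v (p v i) ≤ dist v w)
    (hptie : ∀ v : V, ∀ i : ℕ, i + 1 ≤ k - 1 →
      dist v (p v i) = dist v (p v (i + 1)) → p v i = p v (i + 1))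
    (v : V) (i j : ℕ) (hij : i ≤ j) (hj : j ≤ k - 1)
    (hmem : p v i ∈ A j) :
    p v i = p v j := by
  induction j, hij using Nat.le_induction with
  | base => rfl
  | succ j hij ih =>
    have h := ih (by omega) (hAanti j (by omega) hmem)
    rw [h] at hmem ⊢
    exact hptie v j hj (le_antisymm
      (hpmin v j (by omega) _ (hAanti j (by omega) (hpmem v (j + 1) hj)))
      (hpmin v (j + 1) hj _ hmem))
end

section
/- Fix any u, v ∈ V, and let 0 ≤ j ≤ k−1 be the smallest index such that p_j(v) ∈ B(u) (such j exists, since p_{k−1}(v) ∈ A_{k−1} = B_{k−1}(u) ⊆ B(u)). Then dist(v, p_j(v)) + dist(u, p_j(v)) ≤ (4k−3)·dist(u,v). -/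
/-- If `j ≤ k-1` is the smallest index such that `p_j(v) ∈ B(u)`, then
`dist(v, p_j(v)) + dist(u, p_j(v)) ≤ (4k−3)·dist(u,v)`. -/
theorem four_k_sub_three_bound
    {V : Type*} [MetricSpace V] [Fintype V]
    (k : ℕ) (hk : 2 ≤ k)
    -- the nested sets `V = A_0 ⊇ A_1 ⊇ ⋯ ⊇ A_{k-1}`, `A_k = ∅`
    (A : ℕ → Set V)
    (hA0 : A 0 = Set.univ)
    (hAanti : ∀ i < k, A (i + 1) ⊆ A i)
    (hAne : (A (k - 1)).Nonempty)
    (hAk : A k = ∅)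
    -- the pivots `p_i(v)`, chosen with consistent tie-breaking
    (p : V → ℕ → V)
    (hpmem : ∀ v : V, ∀ i ≤ k - 1, p v i ∈ A i)
    (hpmin : ∀ v : V, ∀ i ≤ k - 1, ∀ w ∈ A i, dist v (p v i) ≤ dist v w)
    (hptie : ∀ v : V, ∀ i : ℕ, i + 1 ≤ k - 1 →
      dist v (p v i) = dist v (p v (i + 1)) → p v i = p v (i + 1))
    -- the bunch `B(v) = ⋃_{i ≤ k-1} B_i(v)` (dist to the empty set is ∞)
    (B : V → Set V)
    (hB : ∀ v u : V, u ∈ B v ↔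
      ∃ i ≤ k - 1, u ∈ A i ∧ ∀ w ∈ A (i + 1), dist v u < dist v w)
    (u v : V) (j : ℕ) (hj : j ≤ k - 1)
    -- `j` is the smallest index with `p_j(v) ∈ B(u)`
    (hjmem : p v j ∈ B u)
    (hjmin : ∀ j' < j, p v j' ∉ B u) :
    dist v (p v j) + dist u (p v j) ≤ (4 * (k : ℝ) - 3) * dist u v := by
  have key : ∀ i ≤ j, dist v (p v i) ≤ 2 * (i : ℝ) * dist u v := by
    intro i
    induction i with
    | zero =>
      intro _
      have h := hpmin v 0 (Nat.zero_le _) v (by rw [hA0]; exact Set.mem_univ v)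
      simpa using h
    | succ i ih =>
      intro hi
      have h1 := ih (by omega)
      have h2 := hjmin i (by omega)
      rw [hB] at h2
      push Not at h2
      obtain ⟨w, hw, hle⟩ := h2 i (by omega) (hpmem v i (by omega))
      have h3 := hpmin v (i + 1) (by omega) w hw
      have h4 := dist_triangle v u w
      have h5 := dist_triangle u v (p v i)
      have h6 := dist_comm v u
      push_cast
      linarith
  have h1 := key j le_rfl
  have h2 := dist_triangle u v (p v j)
  have h3 : (j : ℝ) + 1 ≤ k := by
    have : j + 1 ≤ k := by omega
    exact_mod_cast this
  have h4 := mul_le_mul_of_nonneg_right h3 (dist_nonneg (x := u) (y := v))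
  linarith
end

section
/- Fix any u, v ∈ V, and let 0 ≤ j ≤ k−1 be the smallest index such that p_j(v) ∈ B(u). Then for every 0 ≤ i ≤ j it holds that dist(v, p_i(v)) ≤ 2i·dist(u,v) and dist(u, p_i(v)) ≤ (2i+1)·dist(u,v). -/
/-- If `j ≤ k-1` is the smallest index such that `p_j(v) ∈ B(u)`, then for
every `i ≤ j`, `dist(v, p_i(v)) ≤ 2i·dist(u,v)` and `dist(u, p_i(v)) ≤ (2i+1)·dist(u,v)`. -/
theorem pivot_distance_induction
    {V : Type*} [MetricSpace V] [Fintype V]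
    (k : ℕ) (hk : 2 ≤ k)
    -- the nested sets `V = A_0 ⊇ A_1 ⊇ ⋯ ⊇ A_{k-1}`, `A_k = ∅`
    (A : ℕ → Set V)
    (hA0 : A 0 = Set.univ)
    (hAanti : ∀ i < k, A (i + 1) ⊆ A i)
    (hAne : (A (k - 1)).Nonempty)
    (hAk : A k = ∅)
    -- the pivots `p_i(v)`, chosen with consistent tie-breaking
    (p : V → ℕ → V)
    (hpmem : ∀ v : V, ∀ i ≤ k - 1, p v i ∈ A i)
    (hpmin : ∀ v : V, ∀ i ≤ k - 1, ∀ w ∈ A i, dist v (p v i) ≤ dist v w)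
    (hptie : ∀ v : V, ∀ i : ℕ, i + 1 ≤ k - 1 →
      dist v (p v i) = dist v (p v (i + 1)) → p v i = p v (i + 1))
    -- the bunch `B(v) = ⋃_{i ≤ k-1} B_i(v)` (dist to the empty set is ∞)
    (B : V → Set V)
    (hB : ∀ v u : V, u ∈ B v ↔
      ∃ i ≤ k - 1, u ∈ A i ∧ ∀ w ∈ A (i + 1), dist v u < dist v w)
    (u v : V) (j : ℕ) (hj : j ≤ k - 1)
    -- `j` is the smallest index with `p_j(v) ∈ B(u)`
    (hjmem : p v j ∈ B u)
    (hjmin : ∀ j' < j, p v j' ∉ B u)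
    (i : ℕ) (hi : i ≤ j) :
    dist v (p v i) ≤ 2 * (i : ℝ) * dist u v ∧
      dist u (p v i) ≤ (2 * (i : ℝ) + 1) * dist u v := by
  induction i with
  | zero =>
    have h := hpmin v 0 (Nat.zero_le _) v (by rw [hA0]; trivial)
    rw [dist_self] at h
    have ht := dist_triangle u v (p v 0)
    constructor
    · simpa using h
    · push_cast
      linarith
  | succ n ih =>
    obtain ⟨_, h2⟩ := ih (by omega)
    have hn := hjmin n (by omega)
    rw [hB] at hn
    push Not at hn
    obtain ⟨w, hw, hle⟩ := hn n (by omega) (hpmem v n (by omega))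
    have h3 := hpmin v (n + 1) (by omega) w hw
    have h4 := dist_triangle v u w
    have h5 := dist_triangle u v (p v (n + 1))
    rw [dist_comm v u] at h4
    push_cast
    constructor <;> linarith
end

section
/- Fix any u, v ∈ V, let 0 ≤ j ≤ k−1 be the smallest index such that p_j(v) ∈ B(u), and suppose additionally that dist(v, p_1(v)) ≤ dist(u,v). Then dist(v, p_j(v)) + dist(u, p_j(v)) ≤ (4k−5)·dist(u,v). -/
/-- If `j ≤ k-1` is the smallest index such that `p_j(v) ∈ B(u)`, and in
addition `dist(v, p_1(v)) ≤ dist(u,v)`, then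
`dist(v, p_j(v)) + dist(u, p_j(v)) ≤ (4k−5)·dist(u,v)`. -/
theorem four_k_sub_five_bound
    {V : Type*} [MetricSpace V] [Fintype V]
    (k : ℕ) (hk : 2 ≤ k)
    -- the nested sets `V = A_0 ⊇ A_1 ⊇ ⋯ ⊇ A_{k-1}`, `A_k = ∅`
    (A : ℕ → Set V)
    (hA0 : A 0 = Set.univ)
    (hAanti : ∀ i < k, A (i + 1) ⊆ A i)
    (hAne : (A (k - 1)).Nonempty)
    (hAk : A k = ∅)
    -- the pivots `p_i(v)`, chosen with consistent tie-breaking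
    (p : V → ℕ → V)
    (hpmem : ∀ v : V, ∀ i ≤ k - 1, p v i ∈ A i)
    (hpmin : ∀ v : V, ∀ i ≤ k - 1, ∀ w ∈ A i, dist v (p v i) ≤ dist v w)
    (hptie : ∀ v : V, ∀ i : ℕ, i + 1 ≤ k - 1 →
      dist v (p v i) = dist v (p v (i + 1)) → p v i = p v (i + 1))
    -- the bunch `B(v) = ⋃_{i ≤ k-1} B_i(v)` (dist to the empty set is ∞)
    (B : V → Set V)
    (hB : ∀ v u : V, u ∈ B v ↔
      ∃ i ≤ k - 1, u ∈ A i ∧ ∀ w ∈ A (i + 1), dist v u < dist v w)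
    (u v : V) (j : ℕ) (hj : j ≤ k - 1)
    -- `j` is the smallest index with `p_j(v) ∈ B(u)`
    (hjmem : p v j ∈ B u)
    (hjmin : ∀ j' < j, p v j' ∉ B u)
    -- the additional assumption on the first pivot
    (hfirst : dist v (p v 1) ≤ dist u v) :
    dist v (p v j) + dist u (p v j) ≤ (4 * (k : ℝ) - 5) * dist u v := by
  have hd : 0 ≤ dist u v := dist_nonneg
  have hk' : (2 : ℝ) ≤ k := by exact_mod_cast hk
  have htri : dist u (p v j) ≤ dist u v + dist v (p v j) := dist_triangle _ _ _
  have key : ∀ i : ℕ, i + 1 ≤ j → dist v (p v (i + 1)) ≤ (2 * (i : ℝ) + 1) * dist u v := by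
    intro i
    induction i with
    | zero => intro _; simpa using hfirst
    | succ i ih =>
      intro hi
      have h1 := ih (by omega)
      have h2 := hjmin (i + 1) (by omega)
      rw [hB] at h2
      push Not at h2
      obtain ⟨w, hw, hle⟩ := h2 (i + 1) (by omega) (hpmem v (i + 1) (by omega))
      have h3 := hpmin v (i + 1 + 1) (by omega) w hw
      have h4 := dist_triangle v u w
      have h5 := dist_triangle u v (p v (i + 1))
      rw [dist_comm v u] at h4
      push_cast
      linarith
  rcases j with _ | i
  · have h0 := hpmin v 0 (by omega) v (by rw [hA0]; trivial)
    rw [dist_self] at h0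
    nlinarith
  · have h1 := key i le_rfl
    have h2 : (i : ℝ) + 2 ≤ k := by
      have : i + 2 ≤ k := by omega
      exact_mod_cast this
    nlinarith
end

section
/- Fix any u, v ∈ V, and let 0 ≤ i ≤ k−1 be the smallest index such that p_i(v) ∈ B(u) or p_i(u) ∈ B(v) (such i exists, since p_{k−1}(v) ∈ A_{k−1} ⊆ B(u)). Then dist(v, p_i(v)) + dist(p_i(v), u) ≤ (2i+1)·dist(u,v). -/
/-- If `i ≤ k-1` is the smallest index such that `p_i(v) ∈ B(u)` or
`p_i(u) ∈ B(v)`, then `dist(v, p_i(v)) + dist(p_i(v), u) ≤ (2i+1)·dist(u,v)`. -/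
theorem two_i_add_one_bound
    {V : Type*} [MetricSpace V] [Fintype V]
    (k : ℕ) (hk : 2 ≤ k)
    -- the nested sets `V = A_0 ⊇ A_1 ⊇ ⋯ ⊇ A_{k-1}`, `A_k = ∅`
    (A : ℕ → Set V)
    (hA0 : A 0 = Set.univ)
    (hAanti : ∀ i < k, A (i + 1) ⊆ A i)
    (hAne : (A (k - 1)).Nonempty)
    (hAk : A k = ∅)
    -- the pivots `p_i(v)`, chosen with consistent tie-breaking
    (p : V → ℕ → V)
    (hpmem : ∀ v : V, ∀ i ≤ k - 1, p v i ∈ A i)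
    (hpmin : ∀ v : V, ∀ i ≤ k - 1, ∀ w ∈ A i, dist v (p v i) ≤ dist v w)
    (hptie : ∀ v : V, ∀ i : ℕ, i + 1 ≤ k - 1 →
      dist v (p v i) = dist v (p v (i + 1)) → p v i = p v (i + 1))
    -- the bunch `B(v) = ⋃_{i ≤ k-1} B_i(v)` (dist to the empty set is ∞)
    (B : V → Set V)
    (hB : ∀ v u : V, u ∈ B v ↔
      ∃ i ≤ k - 1, u ∈ A i ∧ ∀ w ∈ A (i + 1), dist v u < dist v w)
    (u v : V) (i : ℕ) (hi : i ≤ k - 1)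
    -- `i` is the smallest index with `p_i(v) ∈ B(u)` or `p_i(u) ∈ B(v)`
    (himem : p v i ∈ B u ∨ p u i ∈ B v)
    (himin : ∀ i' < i, p v i' ∉ B u ∧ p u i' ∉ B v) :
    dist v (p v i) + dist (p v i) u ≤ (2 * (i : ℝ) + 1) * dist u v := by
  have key : ∀ j : ℕ, j ≤ i →
      dist v (p v j) ≤ (j : ℝ) * dist u v ∧ dist u (p u j) ≤ (j : ℝ) * dist u v := by
    intro j
    induction j with
    | zero =>
      intro _
      have h1 := hpmin v 0 (Nat.zero_le _) v (by rw [hA0]; trivial)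
      have h2 := hpmin u 0 (Nat.zero_le _) u (by rw [hA0]; trivial)
      rw [dist_self] at h1 h2
      simpa using And.intro h1 h2
    | succ j ih =>
      intro hj
      obtain ⟨ihv, ihu⟩ := ih (by omega)
      obtain ⟨hv, hu⟩ := himin j (by omega)
      have step : ∀ x y : V, p y j ∉ B x → dist x (p x (j + 1)) ≤ dist x (p y j) := by
        intro x y h
        by_contra hc
        apply h
        rw [hB]
        refine ⟨j, by omega, hpmem y j (by omega), fun w hw => ?_⟩
        exact lt_of_lt_of_le (not_le.mp hc) (hpmin x (j + 1) (by omega) w hw)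
      have h1 := step u v hv
      have h2 := step v u hu
      have t1 := dist_triangle u v (p v j)
      have t2 := dist_triangle v u (p u j)
      rw [dist_comm v u] at t2
      push_cast
      constructor <;> linarith
  have h := (key i le_rfl).1
  have t := dist_triangle (p v i) v u
  rw [dist_comm (p v i) v, dist_comm v u] at t
  linarith
end

section
/- Fix any u, v ∈ V, and let 0 ≤ i ≤ k−1 be the smallest index such that p_i(v) ∈ B(u) or p_i(u) ∈ B(v). Then for every 0 ≤ j ≤ i it holds that dist(v, p_j(v)) ≤ j·dist(u,v) and dist(u, p_j(u)) ≤ j·dist(u,v). -/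
/-- If `i ≤ k-1` is the smallest index such that `p_i(v) ∈ B(u)` or
`p_i(u) ∈ B(v)`, then for every `j ≤ i`, `dist(v, p_j(v)) ≤ j·dist(u,v)` and
`dist(u, p_j(u)) ≤ j·dist(u,v)`. -/
theorem two_sided_pivot_induction
    {V : Type*} [MetricSpace V] [Fintype V]
    (k : ℕ) (hk : 2 ≤ k)
    -- the nested sets `V = A_0 ⊇ A_1 ⊇ ⋯ ⊇ A_{k-1}`, `A_k = ∅`
    (A : ℕ → Set V)
    (hA0 : A 0 = Set.univ)
    (hAanti : ∀ i < k, A (i + 1) ⊆ A i)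
    (hAne : (A (k - 1)).Nonempty)
    (hAk : A k = ∅)
    -- the pivots `p_i(v)`, chosen with consistent tie-breaking
    (p : V → ℕ → V)
    (hpmem : ∀ v : V, ∀ i ≤ k - 1, p v i ∈ A i)
    (hpmin : ∀ v : V, ∀ i ≤ k - 1, ∀ w ∈ A i, dist v (p v i) ≤ dist v w)
    (hptie : ∀ v : V, ∀ i : ℕ, i + 1 ≤ k - 1 →
      dist v (p v i) = dist v (p v (i + 1)) → p v i = p v (i + 1))
    -- the bunch `B(v) = ⋃_{i ≤ k-1} B_i(v)` (dist to the empty set is ∞)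
    (B : V → Set V)
    (hB : ∀ v u : V, u ∈ B v ↔
      ∃ i ≤ k - 1, u ∈ A i ∧ ∀ w ∈ A (i + 1), dist v u < dist v w)
    (u v : V) (i : ℕ) (hi : i ≤ k - 1)
    -- `i` is the smallest index with `p_i(v) ∈ B(u)` or `p_i(u) ∈ B(v)`
    (himem : p v i ∈ B u ∨ p u i ∈ B v)
    (himin : ∀ i' < i, p v i' ∉ B u ∧ p u i' ∉ B v)
    (j : ℕ) (hj : j ≤ i) :
    dist v (p v j) ≤ (j : ℝ) * dist u v ∧ dist u (p u j) ≤ (j : ℝ) * dist u v := by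
  induction j with
  | zero =>
    have h1 := hpmin v 0 (Nat.zero_le _) v (by rw [hA0]; trivial)
    have h2 := hpmin u 0 (Nat.zero_le _) u (by rw [hA0]; trivial)
    rw [dist_self] at h1 h2
    simpa using And.intro h1 h2
  | succ j ih =>
    obtain ⟨ihv, ihu⟩ := ih (by omega)
    obtain ⟨nv, nu⟩ := himin j (by omega)
    have key : ∀ a b : V, p a j ∉ B b →
        dist b (p b (j + 1)) ≤ dist b a + dist a (p a j) := by
      intro a b h
      rw [hB] at h
      push Not at h
      obtain ⟨w, hw, hle⟩ := h j (by omega) (hpmem a j (by omega))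
      exact (hpmin b (j + 1) (by omega) w hw).trans (hle.trans (dist_triangle _ _ _))
    have h1 := key v u nv
    have h2 := key u v nu
    rw [dist_comm v u] at h2
    push_cast
    constructor <;> linarith
end

section
/- Fix any u, v ∈ V, and let 0 ≤ i ≤ k−1 be the smallest index such that p_i(v) ∈ B(u) or p_i(u) ∈ B(v). If p_i(u) ∈ A_{k−1} and i ≤ k−2, then dist(v, p_{k−1}(v)) + dist(p_{k−1}(v), u) ≤ (2i+3)·dist(u,v); in particular this quantity is at most (2k−1)·dist(u,v). -/
/-- If `i ≤ k-1` is the smallest index such that `p_i(v) ∈ B(u)` or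
`p_i(u) ∈ B(v)`, and `p_i(u) ∈ A_{k-1}` with `i ≤ k-2`, then
`dist(v, p_{k-1}(v)) + dist(p_{k-1}(v), u) ≤ (2i+3)·dist(u,v) ≤ (2k−1)·dist(u,v)`. -/
theorem last_level_bound
    {V : Type*} [MetricSpace V] [Fintype V]
    (k : ℕ) (hk : 2 ≤ k)
    -- the nested sets `V = A_0 ⊇ A_1 ⊇ ⋯ ⊇ A_{k-1}`, `A_k = ∅`
    (A : ℕ → Set V)
    (hA0 : A 0 = Set.univ)
    (hAanti : ∀ i < k, A (i + 1) ⊆ A i)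
    (hAne : (A (k - 1)).Nonempty)
    (hAk : A k = ∅)
    -- the pivots `p_i(v)`, chosen with consistent tie-breaking
    (p : V → ℕ → V)
    (hpmem : ∀ v : V, ∀ i ≤ k - 1, p v i ∈ A i)
    (hpmin : ∀ v : V, ∀ i ≤ k - 1, ∀ w ∈ A i, dist v (p v i) ≤ dist v w)
    (hptie : ∀ v : V, ∀ i : ℕ, i + 1 ≤ k - 1 →
      dist v (p v i) = dist v (p v (i + 1)) → p v i = p v (i + 1))
    -- the bunch `B(v) = ⋃_{i ≤ k-1} B_i(v)` (dist to the empty set is ∞)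
    (B : V → Set V)
    (hB : ∀ v u : V, u ∈ B v ↔
      ∃ i ≤ k - 1, u ∈ A i ∧ ∀ w ∈ A (i + 1), dist v u < dist v w)
    (u v : V) (i : ℕ) (hi : i ≤ k - 1)
    -- `i` is the smallest index with `p_i(v) ∈ B(u)` or `p_i(u) ∈ B(v)`
    (himem : p v i ∈ B u ∨ p u i ∈ B v)
    (himin : ∀ i' < i, p v i' ∉ B u ∧ p u i' ∉ B v)
    (hlast : p u i ∈ A (k - 1)) (hik : i ≤ k - 2) :
    dist v (p v (k - 1)) + dist (p v (k - 1)) u ≤ (2 * (i : ℝ) + 3) * dist u v ∧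
      dist v (p v (k - 1)) + dist (p v (k - 1)) u ≤ (2 * (k : ℝ) - 1) * dist u v := by
  have key : ∀ j ≤ i, dist u (p u j) ≤ (j : ℝ) * dist u v ∧
      dist v (p v j) ≤ (j : ℝ) * dist u v := by
    intro j
    induction j with
    | zero =>
      intro _
      have h1 := hpmin u 0 (by omega) u (by rw [hA0]; trivial)
      have h2 := hpmin v 0 (by omega) v (by rw [hA0]; trivial)
      rw [dist_self] at h1 h2
      simp only [Nat.cast_zero, zero_mul]
      exact ⟨h1, h2⟩
    | succ j ih =>
      intro hj
      obtain ⟨h1, h2⟩ := ih (by omega)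
      have step : ∀ x y : V, p y j ∉ B x →
          dist x (p x (j + 1)) ≤ dist x y + dist y (p y j) := by
        intro x y hn
        rw [hB] at hn
        have h3 : ∃ w ∈ A (j + 1), dist x w ≤ dist x (p y j) := by
          by_contra hc
          push Not at hc
          exact hn ⟨j, by omega, hpmem y j (by omega), hc⟩
        obtain ⟨w, hw, hle⟩ := h3
        have h4 := hpmin x (j + 1) (by omega) w hw
        have h5 := dist_triangle x y (p y j)
        linarith
      have ha := step u v (himin j (by omega)).1
      have hb := step v u (himin j (by omega)).2
      rw [dist_comm v u] at hb
      push_cast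
      constructor <;> linarith
  have h1 := (key i le_rfl).1
  have h2 := hpmin v (k - 1) le_rfl _ hlast
  have h3 := dist_triangle v u (p u i)
  have h4 := dist_triangle (p v (k - 1)) v u
  rw [dist_comm v u] at h3 h4
  rw [dist_comm (p v (k - 1)) v] at h4
  have h5 : dist v (p v (k - 1)) + dist (p v (k - 1)) u ≤ (2 * (i : ℝ) + 3) * dist u v := by
    linarith
  refine ⟨h5, h5.trans ?_⟩
  have h6 : (i : ℝ) + 2 ≤ k := by
    have : i + 2 ≤ k := by omega
    exact_mod_cast this
  exact mul_le_mul_of_nonneg_right (by linarith) dist_nonneg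
end

section
/- Fix v ∈ V and a label λ ∈ L, and suppose v ∈ C(λ). Let u ∈ V_λ \ A_1 be a vertex with v ∈ C(u) that minimizes dist(v,u) over all such vertices (i.e., dist(v,u) = min{dist(v,x) : x ∈ V_λ \ A_1, v ∈ C(x)}). Then u is a nearest vertex of label λ to v, i.e., dist(v,u) = dist(v, V_λ). -/
/-- If `v ∈ C(λ)` and `u ∈ V_λ \ A_1` is a vertex with `v ∈ C(u)`
minimizing `dist(v,u)` among all such vertices, then `u` is a nearest vertex of label `λ`
to `v`, i.e. `dist(v,u) = dist(v, V_λ)`. -/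
theorem cluster_label_nearest
    {V : Type*} [MetricSpace V] [Fintype V]
    (k : ℕ) (hk : 2 ≤ k)
    -- the nested sets `V = A_0 ⊇ A_1 ⊇ ⋯ ⊇ A_{k-1}`, `A_k = ∅`
    (A : ℕ → Set V)
    (hA0 : A 0 = Set.univ)
    (hAanti : ∀ i < k, A (i + 1) ⊆ A i)
    (hAne : (A (k - 1)).Nonempty)
    (hAk : A k = ∅)
    -- the (nonempty) set of vertices of label `λ`
    (Vl : Set V) (hVl : Vl.Nonempty)
    -- the clusters `C(x) = {w : dist(x,w) < dist(w, A_1)}` of first-level vertices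
    (C : V → Set V)
    (hC : ∀ x : V, x ∉ A 1 → ∀ w : V, (w ∈ C x ↔ ∀ z ∈ A 1, dist x w < dist w z))
    (v u : V)
    -- `u ∈ V_λ \ A_1` with `v ∈ C(u)`, minimizing `dist(v,·)` among all such vertices
    (huVl : u ∈ Vl) (huA1 : u ∉ A 1) (hvCu : v ∈ C u)
    (humin : ∀ x ∈ Vl, x ∉ A 1 → v ∈ C x → dist v u ≤ dist v x) :
    dist v u = Metric.infDist v Vl := by
  refine le_antisymm ((Metric.le_infDist hVl).2 ?_) (Metric.infDist_le_dist_of_mem huVl)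
  intro y hy
  by_contra hlt
  have hlt' : dist v y < dist v u := not_le.mp hlt
  have h := (hC u huA1 v).1 hvCu
  rw [dist_comm u v] at h
  have hyA : y ∉ A 1 := fun hyA => absurd (h y hyA) (not_lt.mpr hlt'.le)
  refine hlt (humin y hy hyA ((hC y hyA v).2 ?_))
  intro z hz
  rw [dist_comm y v]
  exact hlt'.trans (h z hz)
end

section
/- Fix v ∈ V and a label λ ∈ L, and suppose v ∉ C(λ). Then dist(v, A_1) ≤ dist(v, V_λ); that is, the first pivot of v is no farther from v than the nearest vertex of label λ. -/
/-- If `v ∉ C(λ)`, then `dist(v, A_1) ≤ dist(v, V_λ)`: the first pivot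
of `v` is no farther from `v` than the nearest vertex of label `λ`. -/
theorem not_mem_labelCluster_pivot_bound
    {V : Type*} [MetricSpace V] [Fintype V]
    (k : ℕ) (hk : 2 ≤ k)
    -- the nested sets `V = A_0 ⊇ A_1 ⊇ ⋯ ⊇ A_{k-1}`, `A_k = ∅`
    (A : ℕ → Set V)
    (hA0 : A 0 = Set.univ)
    (hAanti : ∀ i < k, A (i + 1) ⊆ A i)
    (hAne : (A (k - 1)).Nonempty)
    (hAk : A k = ∅)
    -- the (nonempty) set of vertices of label `λ`
    (Vl : Set V) (hVl : Vl.Nonempty)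
    -- the clusters `C(x) = {w : dist(x,w) < dist(w, A_1)}` of first-level vertices
    (C : V → Set V)
    (hC : ∀ x : V, x ∉ A 1 → ∀ w : V, (w ∈ C x ↔ ∀ z ∈ A 1, dist x w < dist w z))
    (v : V)
    -- `v ∉ C(λ) = ⋃_{x ∈ V_λ \ A_1} C(x)`
    (hv : ∀ x ∈ Vl, x ∉ A 1 → v ∉ C x) :
    Metric.infDist v (A 1) ≤ Metric.infDist v Vl := by
  rw [Metric.le_infDist hVl]
  intro x hx
  by_cases h : x ∈ A 1
  · exact Metric.infDist_le_dist_of_mem h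
  · have h2 := hv x hx h
    rw [hC x h v] at h2
    push Not at h2
    obtain ⟨z, hz, hle⟩ := h2
    rw [dist_comm x v] at hle
    exact (Metric.infDist_le_dist_of_mem hz).trans hle
end

section
/- Fix v ∈ V and a label λ ∈ L. For each 0 ≤ i ≤ k−2, define D_i = dist(v, p_i(v)) + min{dist(p_i(v), x) : x ∈ V_λ and p_i(v) ∈ B̃(x)} if some x ∈ V_λ satisfies p_i(v) ∈ B̃(x), and D_i = ∞ otherwise; define D_{k−1} = dist(v, p_{k−1}(v)) + dist(p_{k−1}(v), V_λ). Then dist(v, V_λ) ≤ min_{0 ≤ i ≤ k−1} D_i ≤ (4k−3)·dist(v, V_λ). -/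
open scoped ENNReal

/-- For the quantities `D_i` computed by the query algorithm (with
`D_i = ∞` when undefined), `dist(v, V_λ) ≤ min_{0 ≤ i ≤ k−1} D_i ≤ (4k−3)·dist(v, V_λ)`. -/
theorem query_four_k_sub_three
    {V : Type*} [MetricSpace V] [Fintype V]
    (k : ℕ) (hk : 2 ≤ k)
    -- the nested sets `V = A_0 ⊇ A_1 ⊇ ⋯ ⊇ A_{k-1}`, `A_k = ∅`
    (A : ℕ → Set V)
    (hA0 : A 0 = Set.univ)
    (hAanti : ∀ i < k, A (i + 1) ⊆ A i)
    (hAne : (A (k - 1)).Nonempty)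
    (hAk : A k = ∅)
    -- the pivots `p_i(v)`, chosen with consistent tie-breaking
    (p : V → ℕ → V)
    (hpmem : ∀ v : V, ∀ i ≤ k - 1, p v i ∈ A i)
    (hpmin : ∀ v : V, ∀ i ≤ k - 1, ∀ w ∈ A i, dist v (p v i) ≤ dist v w)
    (hptie : ∀ v : V, ∀ i : ℕ, i + 1 ≤ k - 1 →
      dist v (p v i) = dist v (p v (i + 1)) → p v i = p v (i + 1))
    -- the truncated bunches `B̃(x) = ⋃_{i ≤ k-2} B_i(x)`
    (Bt : V → Set V)
    (hBt : ∀ x u : V, u ∈ Bt x ↔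
      ∃ i ≤ k - 2, u ∈ A i ∧ ∀ w ∈ A (i + 1), dist x u < dist x w)
    -- the (nonempty) set of vertices of label `λ`
    (Vl : Set V) (hVl : Vl.Nonempty)
    (v : V)
    -- the values computed by the query algorithm (`⊤` plays the role of `∞`;
    -- an infimum over the empty set is `⊤`)
    (D : ℕ → ℝ≥0∞)
    (hD : ∀ i ≤ k - 2, D i = ENNReal.ofReal (dist v (p v i)) +
      ⨅ x ∈ {x : V | x ∈ Vl ∧ p v i ∈ Bt x}, ENNReal.ofReal (dist (p v i) x))
    (hDlast : D (k - 1) =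
      ENNReal.ofReal (dist v (p v (k - 1)) + Metric.infDist (p v (k - 1)) Vl)) :
    ENNReal.ofReal (Metric.infDist v Vl) ≤ (⨅ i ∈ Set.Iic (k - 1), D i) ∧
      (⨅ i ∈ Set.Iic (k - 1), D i) ≤
        ENNReal.ofReal ((4 * (k : ℝ) - 3) * Metric.infDist v Vl) := by
  obtain ⟨x, hx, hxd⟩ := (Set.toFinite Vl).isCompact.exists_infDist_eq_dist hVl v
  constructor
  · refine le_iInf₂ fun i hi => ?_
    have hi' : i ≤ k - 1 := hi
    rcases Nat.lt_or_ge (k - 2) i with h | h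
    · obtain rfl : i = k - 1 := by omega
      rw [hDlast]
      apply ENNReal.ofReal_le_ofReal
      have := Metric.infDist_le_infDist_add_dist (s := Vl) (x := v) (y := p v (k - 1))
      linarith
    · rw [hD i h, ← tsub_le_iff_left]
      refine le_iInf₂ fun y hy => ?_
      rw [tsub_le_iff_left, ← ENNReal.ofReal_add dist_nonneg dist_nonneg]
      apply ENNReal.ofReal_le_ofReal
      exact (Metric.infDist_le_dist_of_mem hy.1).trans (dist_triangle _ _ _)
  · rw [hxd]
    have hd : 0 ≤ dist v x := dist_nonneg
    have key : ∀ i ≤ k - 1, dist v (p v i) ≤ 2 * (i : ℝ) * dist v x →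
        dist v (p v i) + dist (p v i) x ≤ (4 * (k : ℝ) - 3) * dist v x := by
      intro i hi h
      have h1 := dist_triangle_left (p v i) x v
      have h2 : (i : ℝ) + 1 ≤ k := by
        have : i + 1 ≤ k := by omega
        exact_mod_cast this
      have h3 := mul_le_mul_of_nonneg_right h2 hd
      linarith
    have main : ∀ i ≤ k - 1, (⨅ i ∈ Set.Iic (k - 1), D i) ≤
        ENNReal.ofReal ((4 * (k : ℝ) - 3) * dist v x) ∨
        dist v (p v i) ≤ 2 * (i : ℝ) * dist v x := by
      intro i
      induction i with
      | zero =>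
        intro _
        right
        have := hpmin v 0 (by omega) v (by rw [hA0]; trivial)
        simpa using this
      | succ i ih =>
        intro hi
        rcases ih (by omega) with h | h
        · exact Or.inl h
        by_cases hb : p v i ∈ Bt x
        · left
          refine (iInf₂_le i (show i ≤ k - 1 by omega)).trans ?_
          rw [hD i (by omega)]
          refine le_trans ?_ (ENNReal.ofReal_le_ofReal (key i (by omega) h))
          rw [ENNReal.ofReal_add dist_nonneg dist_nonneg]
          gcongr
          exact iInf₂_le x ⟨hx, hb⟩
        · right
          rw [hBt] at hb
          push Not at hb
          obtain ⟨w, hw, hwd⟩ := hb i (by omega) (hpmem v i (by omega))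
          have h1 := hpmin v (i + 1) hi w hw
          have h2 := dist_triangle v x w
          have h3 := dist_triangle_left x (p v i) v
          push_cast
          linarith
    rcases main (k - 1) le_rfl with h | h
    · exact h
    · refine (iInf₂_le (f := fun i (_ : i ∈ Set.Iic (k - 1)) => D i) (k - 1)
        (Set.mem_Iic.2 le_rfl)).trans ?_
      rw [hDlast]
      apply ENNReal.ofReal_le_ofReal
      have := key (k - 1) le_rfl h
      have := Metric.infDist_le_dist_of_mem (x := p v (k - 1)) hx
      linarith
end

section
/- Fix v ∈ V and a label λ ∈ L. For each 0 ≤ i ≤ k−2, define D_i = dist(v, p_i(v)) + min{dist(p_i(v), x) : x ∈ V_λ and p_i(v) ∈ B̃(x)} if some x ∈ V_λ satisfies p_i(v) ∈ B̃(x), and D_i = ∞ otherwise; define D_{k−1} = dist(v, p_{k−1}(v)) + dist(p_{k−1}(v), V_λ). For each w ∈ B̃(v), letting i(w) be the unique index with w ∈ A_{i(w)} \ A_{i(w)+1}, define E_w = dist(v, w) + min{dist(w, x) : x ∈ V_λ and p_{i(w)}(x) = w} if some x ∈ V_λ satisfies p_{i(w)}(x) = w, and E_w = ∞ otherwise. Then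 dist(v, V_λ) ≤ min( min_{0 ≤ i ≤ k−1} D_i , min_{w ∈ B̃(v)} E_w ) ≤ (2k−1)·dist(v, V_λ). -/
open scoped ENNReal

/-- For the quantities `D_i` and `E_w` computed by the improved query
algorithm (with value `∞` when undefined),
`dist(v, V_λ) ≤ min(min_i D_i, min_{w ∈ B̃(v)} E_w) ≤ (2k−1)·dist(v, V_λ)`. -/
theorem query_two_k_sub_one
    {V : Type*} [MetricSpace V] [Fintype V]
    (k : ℕ) (hk : 2 ≤ k)
    -- the nested sets `V = A_0 ⊇ A_1 ⊇ ⋯ ⊇ A_{k-1}`, `A_k = ∅`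
    (A : ℕ → Set V)
    (hA0 : A 0 = Set.univ)
    (hAanti : ∀ i < k, A (i + 1) ⊆ A i)
    (hAne : (A (k - 1)).Nonempty)
    (hAk : A k = ∅)
    -- the pivots `p_i(v)`, chosen with consistent tie-breaking
    (p : V → ℕ → V)
    (hpmem : ∀ v : V, ∀ i ≤ k - 1, p v i ∈ A i)
    (hpmin : ∀ v : V, ∀ i ≤ k - 1, ∀ w ∈ A i, dist v (p v i) ≤ dist v w)
    (hptie : ∀ v : V, ∀ i : ℕ, i + 1 ≤ k - 1 →
      dist v (p v i) = dist v (p v (i + 1)) → p v i = p v (i + 1))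
    -- the truncated bunches `B̃(x) = ⋃_{i ≤ k-2} B_i(x)`
    (Bt : V → Set V)
    (hBt : ∀ x u : V, u ∈ Bt x ↔
      ∃ i ≤ k - 2, u ∈ A i ∧ ∀ w ∈ A (i + 1), dist x u < dist x w)
    -- the (nonempty) set of vertices of label `λ`
    (Vl : Set V) (hVl : Vl.Nonempty)
    (v : V)
    -- the values `D_i` of phases 1 and 3 (`⊤` plays the role of `∞`;
    -- an infimum over the empty set is `⊤`)
    (D : ℕ → ℝ≥0∞)
    (hD : ∀ i ≤ k - 2, D i = ENNReal.ofReal (dist v (p v i)) +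
      ⨅ x ∈ {x : V | x ∈ Vl ∧ p v i ∈ Bt x}, ENNReal.ofReal (dist (p v i) x))
    (hDlast : D (k - 1) =
      ENNReal.ofReal (dist v (p v (k - 1)) + Metric.infDist (p v (k - 1)) Vl))
    -- for `w ∈ B̃(v)`, `iw w` is the unique index with `w ∈ A_{iw w} \ A_{iw w + 1}`
    (iw : V → ℕ)
    (hiw : ∀ w ∈ Bt v, iw w ≤ k - 2 ∧ w ∈ A (iw w) ∧ w ∉ A (iw w + 1))
    -- the values `E_w` of phase 2
    (E : V → ℝ≥0∞)
    (hE : ∀ w ∈ Bt v, E w = ENNReal.ofReal (dist v w) +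
      ⨅ x ∈ {x : V | x ∈ Vl ∧ p x (iw w) = w}, ENNReal.ofReal (dist w x)) :
    ENNReal.ofReal (Metric.infDist v Vl) ≤
        min (⨅ i ∈ Set.Iic (k - 1), D i) (⨅ w ∈ Bt v, E w) ∧
      min (⨅ i ∈ Set.Iic (k - 1), D i) (⨅ w ∈ Bt v, E w) ≤
        ENNReal.ofReal ((2 * (k : ℝ) - 1) * Metric.infDist v Vl) := by
  constructor
  · refine le_min (le_iInf₂ fun i hi => ?_) (le_iInf₂ fun w hw => ?_)
    · rw [Set.mem_Iic] at hi
      by_cases h : i ≤ k - 2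
      · rw [hD i h, ENNReal.add_iInf]
        refine le_iInf fun x => ?_
        rw [ENNReal.add_iInf]
        refine le_iInf fun hx => ?_
        rw [← ENNReal.ofReal_add dist_nonneg dist_nonneg]
        exact ENNReal.ofReal_le_ofReal
          ((Metric.infDist_le_dist_of_mem hx.1).trans (dist_triangle _ _ _))
      · obtain rfl : i = k - 1 := by omega
        rw [hDlast]
        apply ENNReal.ofReal_le_ofReal
        rw [add_comm]
        exact Metric.infDist_le_infDist_add_dist
    · rw [hE w hw, ENNReal.add_iInf]
      refine le_iInf fun x => ?_
      rw [ENNReal.add_iInf]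
      refine le_iInf fun hx => ?_
      rw [← ENNReal.ofReal_add dist_nonneg dist_nonneg]
      exact ENNReal.ofReal_le_ofReal
        ((Metric.infDist_le_dist_of_mem hx.1).trans (dist_triangle _ _ _))
  · obtain ⟨x, hx, hxd⟩ := (Set.toFinite Vl).isCompact.exists_infDist_eq_dist hVl v
    rw [hxd]
    by_contra hcon
    rw [not_le, lt_min_iff] at hcon
    obtain ⟨h1, h2⟩ := hcon
    have hDi : ∀ i ≤ k - 1, ENNReal.ofReal ((2 * (k : ℝ) - 1) * dist v x) < D i :=
      fun i hi => h1.trans_le (iInf₂_le i hi)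
    have hEw : ∀ w ∈ Bt v, ENNReal.ofReal ((2 * (k : ℝ) - 1) * dist v x) < E w :=
      fun w hw => h2.trans_le (iInf₂_le w hw)
    have hd : 0 ≤ dist v x := dist_nonneg
    -- nestedness
    have hanti : ∀ i j, i ≤ j → j ≤ k → A j ⊆ A i := by
      intro i j hij
      induction j, hij using Nat.le_induction with
      | base => intro _; exact subset_rfl
      | succ j hij ih => intro hj; exact (hAanti j (by omega)).trans (ih (by omega))
    have hpiv : ∀ i j, i ≤ j → j ≤ k - 1 → p x i ∈ A j → p x j = p x i := by
      intro i j hij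
      induction j, hij using Nat.le_induction with
      | base => intro _ _; rfl
      | succ j hij ih =>
        intro hj hm
        have e := ih (by omega) (hanti j (j+1) (by omega) (by omega) hm)
        rw [← e]
        refine (hptie x j hj (le_antisymm ?_ ?_)).symm
        · exact hpmin x j (by omega) _ (hAanti j (by omega) (hpmem x (j+1) hj))
        · rw [e]; exact hpmin x (j+1) hj _ hm
    have key : ∀ i ≤ k - 1, dist v (p v i) ≤ i * dist v x ∧ dist x (p x i) ≤ i * dist v x := by
      intro i
      induction i with
      | zero =>
        intro _
        have a := hpmin v 0 (by omega) v (by rw [hA0]; trivial)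
        have b := hpmin x 0 (by omega) x (by rw [hA0]; trivial)
        rw [dist_self] at a b
        simpa using And.intro a b
      | succ i ih =>
        intro hi
        obtain ⟨ha, hb⟩ := ih (by omega)
        have hik : (i : ℝ) + 2 ≤ k := by exact_mod_cast (by omega : i + 2 ≤ k)
        have hmul : (i : ℝ) * dist v x + 2 * dist v x ≤ k * dist v x := by nlinarith
        push_cast
        constructor
        · have hn : p x i ∉ Bt v := by
            intro hm
            obtain ⟨hw1, hw2, hw3⟩ := hiw _ hm
            have hij : i ≤ iw (p x i) := by
              by_contra hlt
              exact hw3 (hanti _ i (by omega) (by omega) (hpmem x i (by omega)))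
            have e := hpiv i _ hij (by omega) hw2
            refine absurd (hEw _ hm) (not_lt.2 ?_)
            rw [hE _ hm]
            refine (add_le_add le_rfl (iInf₂_le x ⟨hx, e⟩)).trans ?_
            rw [← ENNReal.ofReal_add dist_nonneg dist_nonneg]
            apply ENNReal.ofReal_le_ofReal
            have t := dist_triangle v x (p x i)
            rw [dist_comm (p x i) x]
            linarith
          rw [hBt] at hn
          push Not at hn
          obtain ⟨w, hw, hwd⟩ := hn i (by omega) (hpmem x i (by omega))
          have t := dist_triangle v x (p x i)
          have := hpmin v (i+1) hi w hw
          linarith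
        · have hn : p v i ∉ Bt x := by
            intro hm
            refine absurd (hDi i (by omega)) (not_lt.2 ?_)
            rw [hD i (by omega)]
            refine (add_le_add le_rfl (iInf₂_le x ⟨hx, hm⟩)).trans ?_
            rw [← ENNReal.ofReal_add dist_nonneg dist_nonneg]
            apply ENNReal.ofReal_le_ofReal
            have t := dist_triangle (p v i) v x
            rw [dist_comm (p v i) v] at t
            linarith
          rw [hBt] at hn
          push Not at hn
          obtain ⟨w, hw, hwd⟩ := hn i (by omega) (hpmem v i (by omega))
          have t := dist_triangle x v (p v i)
          rw [dist_comm x v] at t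
          have := hpmin x (i+1) hi w hw
          linarith
    refine absurd (hDi (k-1) le_rfl) (not_lt.2 ?_)
    rw [hDlast]
    apply ENNReal.ofReal_le_ofReal
    have t := dist_triangle (p v (k-1)) v x
    rw [dist_comm (p v (k-1)) v] at t
    have t2 : Metric.infDist (p v (k-1)) Vl ≤ _ := Metric.infDist_le_dist_of_mem hx
    have a := (key (k-1) le_rfl).1
    rw [Nat.cast_sub (by omega)] at a
    push_cast at a
    linarith
end

section
/- For every vertex v ∈ V, the expected size of the truncated bunch satisfies E[|B̃(v)|] ≤ (k−1)·ℓ^{1/k}. -/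
open MeasureTheory ProbabilityTheory in
lemma core_aux {V : Type*} [Fintype V] {Ω : Type*} [MeasurableSpace Ω]
    (μ : Measure Ω) [IsProbabilityMeasure μ] (m : ℕ) (q : ℝ) (hq : 0 ≤ q)
    (X : V × Fin m → Ω → Bool)
    (hXmeas : ∀ a, Measurable (X a))
    (hXind : iIndepFun X μ)
    (hXq : ∀ a, μ {ω | X a ω = true} = ENNReal.ofReal q)
    (r : V → V → Prop) (hirr : ∀ u, ¬ r u u) (htot : ∀ u w, u ≠ w → r u w ∨ r w u)
    (i : Fin m) (E : V → Set Ω)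
    (hE : ∀ u, E u = {ω | (∀ j, j < i → X (u, j) ω = true) ∧
      ∀ w, r w u → ¬ ∀ j, j ≤ i → X (w, j) ω = true}) :
    (∀ u, MeasurableSet (E u)) ∧ (∑ u, μ.real (E u)) * q ≤ 1 := by
  classical
  have hZ : ∀ a, MeasurableSet {ω | X a ω = true} := fun a =>
    hXmeas a (measurableSet_singleton true)
  have hkey : ∀ u, MeasurableSet (E u) ∧
      μ.real (E u ∩ {ω | X (u, i) ω = true}) = μ.real (E u) * q := by
    intro u
    let T : Finset (V × Fin m) := Finset.univ.erase (u, i)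
    let S : Finset (V × Fin m) := {(u, i)}
    have hd : Disjoint T S := by simp [T, S]
    have hind := hXind.indepFun_finset T S hd hXmeas
    let ex : (T → Bool) → V × Fin m → Bool := fun y a =>
      if h : a ∈ T then y ⟨a, h⟩ else false
    let G : Set (T → Bool) := {y | (∀ j, j < i → ex y (u, j) = true) ∧
      ∀ w, r w u → ¬ ∀ j, j ≤ i → ex y (w, j) = true}
    let H : Set (S → Bool) := {y | y ⟨(u, i), by simp [S]⟩ = true}
    have hex : ∀ ω a, a ≠ (u, i) → ex (fun b : T => X b ω) a = X a ω := by
      intro ω a ha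
      simp [ex, T, ha]
    have hG : E u = (fun ω (b : T) => X b ω) ⁻¹' G := by
      rw [hE]
      ext ω
      simp only [Set.mem_ofPred_eq, Set.mem_preimage, G]
      refine and_congr (forall_congr' fun j => imp_congr_right fun hj => ?_)
        (forall_congr' fun w => imp_congr_right fun hw => not_congr
          (forall_congr' fun j => imp_congr_right fun hj => ?_))
      · rw [hex]
        intro h
        simp only [Prod.mk.injEq, true_and] at h
        exact hj.ne h
      · rw [hex]
        intro h
        simp only [Prod.mk.injEq] at h
        exact hirr u (h.1 ▸ hw)
    have hH : {ω | X (u, i) ω = true} = (fun ω (b : S) => X b ω) ⁻¹' H := rfl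
    have hGm : MeasurableSet G := (Set.toFinite G).measurableSet
    have hHm : MeasurableSet H := (Set.toFinite H).measurableSet
    refine ⟨?_, ?_⟩
    · rw [hG]
      have hm : Measurable (fun ω (b : T) => X b ω) := measurable_pi_lambda _ fun b => hXmeas b
      exact hm hGm
    · have h := hind.measure_inter_preimage_eq_mul G H hGm hHm
      rw [← hG, ← hH, hXq] at h
      simp only [Measure.real]
      rw [h, ENNReal.toReal_mul, ENNReal.toReal_ofReal hq]
  refine ⟨fun u => (hkey u).1, ?_⟩
  rw [Finset.sum_mul]
  have hdisj : ∀ u w, r u w → Disjoint (E u ∩ {ω | X (u, i) ω = true})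
      (E w ∩ {ω | X (w, i) ω = true}) := by
    intro u w h
    rw [Set.disjoint_left]
    rintro ω ⟨h1, h2⟩ ⟨h3, -⟩
    rw [hE] at h1 h3
    refine h3.2 u h fun j hj => ?_
    rcases hj.lt_or_eq with hj | rfl
    · exact h1.1 j hj
    · exact h2
  calc ∑ u, μ.real (E u) * q = ∑ u, μ.real (E u ∩ {ω | X (u, i) ω = true}) :=
        Finset.sum_congr rfl fun u _ => (hkey u).2.symm
    _ = μ.real (⋃ u, (E u ∩ {ω | X (u, i) ω = true})) := by
        rw [measureReal_iUnion_fintype]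
        · intro u w huw
          rcases htot u w huw with h | h
          · exact hdisj u w h
          · exact (hdisj w u h).symm
        · exact fun u => (hkey u).1.inter (hZ _)
    _ ≤ 1 := measureReal_le_one

/-- With sampling probability `q = ℓ^{−1/k}`, the expected size of the
truncated bunch satisfies `E[|B̃(v)|] ≤ (k−1)·ℓ^{1/k}`. -/
theorem expected_truncBunch_size
    {V : Type*} [MetricSpace V] [Fintype V] {Ω : Type*} [MeasurableSpace Ω]
    (μ : MeasureTheory.Measure Ω) [MeasureTheory.IsProbabilityMeasure μ]
    (n : ℕ) (hn : Fintype.card V = n)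
    (k : ℕ) (hk : 2 ≤ k)
    (ℓ : ℕ) (hℓ : 2 ≤ ℓ)
    (q : ℝ) (hq : q = (ℓ : ℝ) ^ (-(1 : ℝ) / k))
    -- the i.i.d. Bernoulli(q) sampling variables `X_{v,i}`, `v ∈ V`, `0 ≤ i ≤ k−2`
    (X : V × Fin (k - 1) → Ω → Bool)
    (hXmeas : ∀ a, Measurable (X a))
    (hXind : ProbabilityTheory.iIndepFun X μ)
    (hXq : ∀ a, μ {ω | X a ω = true} = ENNReal.ofReal q)
    -- the random nested sets `A_i = {v : X_{v,0} = ⋯ = X_{v,i−1} = true}`, `0 ≤ i ≤ k−1`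
    (A : ℕ → Ω → Set V)
    (hA : ∀ i ≤ k - 1, ∀ ω,
      A i ω = {v : V | ∀ j : Fin (k - 1), (j : ℕ) < i → X (v, j) ω = true})
    -- the random truncated bunches `B̃(v) = ⋃_{i ≤ k-2} B_i(v)`
    (Bt : V → Ω → Set V)
    (hBt : ∀ v ω, ∀ u : V, u ∈ Bt v ω ↔
      ∃ i ≤ k - 2, u ∈ A i ω ∧ ∀ w ∈ A (i + 1) ω, dist v u < dist v w)
    (v : V) :
    ∫ ω, ((Bt v ω).ncard : ℝ) ∂μ ≤ ((k : ℝ) - 1) * (ℓ : ℝ) ^ ((1 : ℝ) / k) := by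
  classical
  have hℓ0 : (0 : ℝ) < ℓ := by exact_mod_cast (by omega : 0 < ℓ)
  have hq0 : 0 < q := hq ▸ Real.rpow_pos_of_pos hℓ0 _
  have hqinv : (ℓ : ℝ) ^ ((1 : ℝ) / k) = q⁻¹ := by
    rw [hq, ← Real.rpow_neg hℓ0.le]
    congr 1
    ring
  let e := Fintype.equivFin V
  let r : V → V → Prop := fun w u => dist v w < dist v u ∨ (dist v w = dist v u ∧ e w < e u)
  have hirr : ∀ u, ¬ r u u := by intro u; simp [r]
  have htot : ∀ u w, u ≠ w → r u w ∨ r w u := by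
    intro u w huw
    have hne : e u ≠ e w := fun h => huw (e.injective h)
    rcases lt_trichotomy (dist v u) (dist v w) with h | h | h
    · exact Or.inl (Or.inl h)
    · rcases lt_or_gt_of_ne hne with h' | h'
      · exact Or.inl (Or.inr ⟨h, h'⟩)
      · exact Or.inr (Or.inr ⟨h.symm, h'⟩)
    · exact Or.inr (Or.inl h)
  let E : Fin (k - 1) → V → Set Ω := fun i u => {ω | (∀ j, j < i → X (u, j) ω = true) ∧
      ∀ w, r w u → ¬ ∀ j, j ≤ i → X (w, j) ω = true}
  have hc := fun i => core_aux μ (k - 1) q hq0.le X hXmeas hXind hXq r hirr htot i (E i)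
    (fun u => rfl)
  have hint : ∀ i u, MeasureTheory.Integrable ((E i u).indicator (fun _ => (1 : ℝ))) μ :=
    fun i u => (MeasureTheory.integrable_const 1).indicator ((hc i).1 u)
  have hle : ∀ ω, ((Bt v ω).ncard : ℝ) ≤
      ∑ i, ∑ u, (E i u).indicator (fun _ => (1 : ℝ)) ω := by
    intro ω
    have h1 : ((Bt v ω).ncard : ℝ) = ∑ u, if u ∈ Bt v ω then (1 : ℝ) else 0 := by
      rw [Finset.sum_boole, Set.ncard_eq_toFinset_card']
      congr 2
      ext u
      simp
    have hnn : ∀ i u, 0 ≤ (E i u).indicator (fun _ => (1 : ℝ)) ω := fun i u =>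
      Set.indicator_nonneg (fun _ _ => zero_le_one) _
    rw [h1, Finset.sum_comm]
    refine Finset.sum_le_sum fun u _ => ?_
    split_ifs with hu
    · obtain ⟨i, hi, hui, hw⟩ := (hBt v ω u).1 hu
      rw [hA i (by omega)] at hui
      rw [hA (i + 1) (by omega)] at hw
      have hmem : ω ∈ E ⟨i, by omega⟩ u := by
        refine ⟨fun j hj => hui j hj, fun w hr hall => ?_⟩
        have hlt := hw w fun j hj => hall j (Nat.lt_succ_iff.1 hj)
        rcases hr with hr | ⟨hr, -⟩ <;> linarith
      calc (1 : ℝ) = (E ⟨i, by omega⟩ u).indicator (fun _ => (1 : ℝ)) ω := by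
            rw [Set.indicator_of_mem hmem]
        _ ≤ _ := Finset.single_le_sum (f := fun i => (E i u).indicator (fun _ => (1 : ℝ)) ω)
            (fun i _ => hnn i u) (Finset.mem_univ _)
    · exact Finset.sum_nonneg fun i _ => hnn i u
  calc ∫ ω, ((Bt v ω).ncard : ℝ) ∂μ
      ≤ ∫ ω, ∑ i, ∑ u, (E i u).indicator (fun _ => (1 : ℝ)) ω ∂μ := by
        refine MeasureTheory.integral_mono_of_nonneg (Filter.Eventually.of_forall fun ω => ?_)
          ?_ (Filter.Eventually.of_forall hle)
        · exact Nat.cast_nonneg _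
        · exact MeasureTheory.integrable_finsetSum _ fun i _ =>
            MeasureTheory.integrable_finsetSum _ fun u _ => hint i u
    _ = ∑ i, ∑ u, μ.real (E i u) := by
        rw [MeasureTheory.integral_finsetSum _ fun i _ =>
            MeasureTheory.integrable_finsetSum _ fun u _ => hint i u]
        refine Finset.sum_congr rfl fun i _ => ?_
        rw [MeasureTheory.integral_finsetSum _ fun u _ => hint i u]
        refine Finset.sum_congr rfl fun u _ => ?_
        rw [MeasureTheory.integral_indicator ((hc i).1 u)]
        simp
    _ ≤ ∑ i : Fin (k - 1), q⁻¹ := by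
        refine Finset.sum_le_sum fun i _ => ?_
        rw [← one_div, le_div_iff₀ hq0]
        exact (hc i).2
    _ = ((k : ℝ) - 1) * (ℓ : ℝ) ^ ((1 : ℝ) / k) := by
        rw [hqinv, Finset.sum_const, Finset.card_univ, Fintype.card_fin, nsmul_eq_mul,
          Nat.cast_sub (by omega), Nat.cast_one]
end

section
/- For every vertex v ∈ V and every positive integer s, if Y is a binomial random variable with parameters s and q, then Pr[|B̃(v)| > s] ≤ Pr[Y < k]. -/
namespace TB

open MeasureTheory ProbabilityTheory

def In {V : Type*} {K : ℕ} (x : V × Fin K → Bool) (i : ℕ) (u : V) : Prop :=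
  ∀ j : Fin K, (j : ℕ) < i → x (u, j) = true

open Classical in
noncomputable def N {V : Type*} {K : ℕ} (x : V × Fin K → Bool) : ℕ → List V → ℕ
  | _, [] => 0
  | m, u :: l => if K ≤ m then 0 else if ¬ In x m u then N x m l
      else if ¬ In x (m+1) u then N x m l + 1 else N x (m+1) l + 1

def F (q : ℝ) : ℕ → ℕ → ℝ
  | 0, _ => 1
  | s+1, 0 => (1-q) * F q s 0
  | s+1, r+1 => (1-q) * F q s (r+1) + q * F q s r

lemma F_nonneg {q : ℝ} (h0 : 0 ≤ q) (h1 : q ≤ 1) (s : ℕ) : ∀ r, 0 ≤ F q s r := by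
  have : 0 ≤ 1 - q := by linarith
  induction s with
  | zero => intro r; simp [F]
  | succ s ih =>
    intro r
    cases r with
    | zero => have := ih 0; simp only [F]; positivity
    | succ r => have := ih r; have := ih (r+1); simp only [F]; positivity

lemma F_zero (q : ℝ) (s : ℕ) : F q s 0 = (1-q)^s := by
  induction s with
  | zero => simp [F]
  | succ s ih => simp only [F, ih]; ring

lemma term_succ (q : ℝ) (s j : ℕ) :
    ((s+1).choose (j+1) : ℝ) * q^(j+1) * (1-q)^(s+1-(j+1)) =
     (1-q) * ((s.choose (j+1) : ℝ) * q^(j+1) * (1-q)^(s-(j+1))) +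
      q * ((s.choose j : ℝ) * q^j * (1-q)^(s-j)) := by
  rw [Nat.choose_succ_succ, Nat.add_sub_add_right]
  push_cast
  rcases Nat.lt_or_ge j s with h | h
  · obtain ⟨t, rfl⟩ := Nat.exists_eq_add_of_lt h
    have e1 : j + t + 1 - j = t + 1 := by omega
    have e2 : j + t + 1 - (j+1) = t := by omega
    rw [e1, e2]; ring
  · rw [Nat.choose_eq_zero_of_lt (by omega : s < j+1)]; push_cast; ring

lemma F_eq (q : ℝ) (s : ℕ) : ∀ r, F q s r =
    ∑ j ∈ Finset.range (r+1), (s.choose j : ℝ) * q ^ j * (1 - q) ^ (s - j) := by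
  induction s with
  | zero =>
    intro r
    rw [Finset.sum_range_succ']
    simp [F]
  | succ s ih =>
    intro r
    cases r with
    | zero => rw [F_zero]; simp
    | succ r =>
      rw [F, ih, ih, Finset.sum_range_succ' _ (r+1), Finset.sum_range_succ' _ (r+1)]
      simp only [term_succ, Finset.sum_add_distrib, Finset.mul_sum, mul_add]
      simp only [Nat.choose_zero_right, Nat.sub_zero, pow_zero, pow_succ]
      push_cast
      ring

lemma In_mono {V : Type*} {K : ℕ} {x : V × Fin K → Bool} {i j : ℕ} (h : i ≤ j) {u : V}
    (hu : In x j u) : In x i u := fun a ha => hu a (lt_of_lt_of_le ha h)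

open Classical in
lemma count_le {V : Type*} {K : ℕ} (x : V × Fin K → Bool) (d : V → ℝ) (B : V → Prop)
    (hB : ∀ u, B u → ∃ i < K, In x i u ∧ ∀ w, In x (i+1) w → d u < d w)
    (l : List V) : ∀ m, l.Pairwise (fun a b => d a ≤ d b) →
      (∀ u ∈ l, 0 < m → ∃ w, d w ≤ d u ∧ In x m w) →
      (l.filter (fun u => B u)).length ≤ N x m l := by
  induction l with
  | nil => intro m _ _; simp
  | cons u l ih =>
    intro m hl hm
    have key : ∀ u' ∈ u :: l, B u' → m < K ∧ In x m u' := by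
      intro u' hu' hb
      obtain ⟨i, hi, h1, h2⟩ := hB u' hb
      have : m ≤ i := by
        by_contra hc
        push Not at hc
        obtain ⟨w, hw, hw2⟩ := hm u' hu' (by omega)
        have := h2 w (In_mono hc hw2)
        linarith
      exact ⟨by omega, In_mono this h1⟩
    have hl' := List.pairwise_cons.1 hl
    have ih1 := ih m hl'.2 (fun u' hu' => hm u' (List.mem_cons_of_mem _ hu'))
    have hf : ((u :: l).filter (fun u => B u)).length ≤ (l.filter (fun u => B u)).length + 1 := by
      rw [List.filter_cons]; split_ifs <;> simp
    unfold N
    split_ifs with c1 c2 c3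
    · rw [Nat.le_zero, List.length_eq_zero_iff, List.filter_eq_nil_iff]
      intro a ha hb
      have := (key a ha (by simpa using hb)).1
      omega
    · have ih2 := ih (m+1) hl'.2 (fun u' hu' _ => ⟨u, hl'.1 u' hu', c3⟩)
      omega
    · omega
    · rw [List.filter_cons_of_neg]
      · exact ih1
      · intro hb
        exact c2 (key u (by simp) (by simpa using hb)).2

lemma N_congr {V : Type*} {K : ℕ} (x y : V × Fin K → Bool) (l : List V) :
    (∀ u ∈ l, ∀ j, x (u, j) = y (u, j)) → ∀ m, N x m l = N y m l := by
  induction l with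
  | nil => intro _ m; simp [N]
  | cons u l ih =>
    intro h m
    have ih' := ih (fun u hu => h u (List.mem_cons_of_mem _ hu))
    have hI : ∀ i, In x i u ↔ In y i u := by
      intro i; unfold In; simp [h u (by simp)]
    unfold N
    by_cases c1 : In y m u <;> by_cases c2 : In y (m+1) u <;> simp [hI, ih', c1, c2]

lemma indep {ι Ω : Type*} [Fintype ι] [MeasurableSpace Ω] (μ : Measure Ω) [IsProbabilityMeasure μ]
    (X : ι → Ω → Bool) (hXm : ∀ a, Measurable (X a)) (hX : iIndepFun X μ)
    (S T : Finset ι) (hST : Disjoint S T) (P Q : (ι → Bool) → Prop)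
    (hP : ∀ x y, (∀ a ∈ S, x a = y a) → P x → P y)
    (hQ : ∀ x y, (∀ a ∈ T, x a = y a) → Q x → Q y) :
    μ.real ({ω | P (fun a => X a ω)} ∩ {ω | Q (fun a => X a ω)}) =
      μ.real {ω | P (fun a => X a ω)} * μ.real {ω | Q (fun a => X a ω)} := by
  classical
  have h := hX.indepFun_finset S T hST hXm
  have gen : ∀ (S : Finset ι) (P : (ι → Bool) → Prop)
    (_ : ∀ x y, (∀ a ∈ S, x a = y a) → P x → P y),
    {ω | P (fun a => X a ω)} = (fun ω (i : S) => X i ω) ⁻¹'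
      {y | P (fun a => if h : a ∈ S then y ⟨a, h⟩ else false)} := by
    intro S P hP
    ext ω
    simp only [Set.mem_ofPred_eq, Set.mem_preimage]
    constructor <;> apply hP <;> intro a ha <;> simp [ha]
  rw [gen S P hP, gen T Q hQ]
  simp only [measureReal_def, ← ENNReal.toReal_mul]
  rw [h.measure_inter_preimage_eq_mul _ _ (Set.toFinite _).measurableSet
    (Set.toFinite _).measurableSet]

lemma prob_In {V Ω : Type*} [Fintype V] [MeasurableSpace Ω] (μ : Measure Ω)
    [IsProbabilityMeasure μ] {K : ℕ} (q : ℝ) (hq0 : 0 ≤ q)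
    (X : V × Fin K → Ω → Bool) (hX : iIndepFun X μ)
    (hXq : ∀ a, μ {ω | X a ω = true} = ENNReal.ofReal q) (u : V) (m : ℕ) (hm : m ≤ K) :
    μ.real {ω | In (fun a => X a ω) m u} = q ^ m := by
  classical
  let J : Finset (Fin K) := Finset.univ.filter (fun j => (j : ℕ) < m)
  have hJ : J.card = m := by
    simp only [J, Fin.card_filter_val_lt]; omega
  let S : Finset (V × Fin K) := J.image (fun j => (u, j))
  have hS : S.card = m := by
    rw [Finset.card_image_of_injective _ (fun a b h => (Prod.mk.inj h).2), hJ]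
  have h := hX.measure_inter_preimage_eq_mul S (sets := fun _ => {true})
    (fun _ _ => (Set.toFinite _).measurableSet)
  have e : {ω | In (fun a => X a ω) m u} = ⋂ i ∈ S, X i ⁻¹' {true} := by
    ext ω; simp [In, S, J]
  have e2 : ∀ a, μ (X a ⁻¹' {true}) = ENNReal.ofReal q := hXq
  rw [measureReal_def, e, h]
  simp [e2, hS, hq0]

lemma main {V Ω : Type*} [Fintype V] [MeasurableSpace Ω] (μ : Measure Ω)
    [IsProbabilityMeasure μ] {K : ℕ} (q : ℝ) (hq0 : 0 ≤ q) (hq1 : q ≤ 1)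
    (X : V × Fin K → Ω → Bool) (hXm : ∀ a, Measurable (X a)) (hX : iIndepFun X μ)
    (hXq : ∀ a, μ {ω | X a ω = true} = ENNReal.ofReal q) (l : List V) :
    l.Nodup → ∀ m ≤ K, ∀ s, μ.real {ω | s ≤ N (fun a => X a ω) m l} ≤ F q s (K - m) := by
  classical
  induction l with
  | nil =>
    intro _ m hm s
    cases s with
    | zero => simp [F]
    | succ s => simpa [N] using F_nonneg hq0 hq1 _ _
  | cons u l ih =>
    intro hl m hm s
    have hl' := List.nodup_cons.1 hl
    cases s with
    | zero => simp [F]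
    | succ s =>
    rcases hm.eq_or_lt with rfl | hm'
    · simpa [N] using F_nonneg hq0 hq1 _ _
    have sub : {ω | s + 1 ≤ N (fun a => X a ω) m (u :: l)} ⊆
        ({ω | ¬ In (fun a => X a ω) m u} ∩ {ω | s + 1 ≤ N (fun a => X a ω) m l}) ∪
        (({ω | In (fun a => X a ω) m u ∧ ¬ In (fun a => X a ω) (m+1) u} ∩
          {ω | s ≤ N (fun a => X a ω) m l}) ∪
        ({ω | In (fun a => X a ω) (m+1) u} ∩ {ω | s ≤ N (fun a => X a ω) (m+1) l})) := by
      intro ω hω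
      simp only [Set.mem_ofPred_eq, N, Set.mem_union, Set.mem_inter_iff] at hω ⊢
      split_ifs at hω with c1 c2 c3
      · omega
      · right; right; exact ⟨c3, by omega⟩
      · right; left; exact ⟨⟨c2, c3⟩, by omega⟩
      · left; exact ⟨c2, hω⟩
    have hdis : Disjoint (({u} : Finset V) ×ˢ (Finset.univ : Finset (Fin K)))
        (l.toFinset ×ˢ (Finset.univ : Finset (Fin K))) := by
      rw [Finset.disjoint_left]
      rintro ⟨a, b⟩ h1 h2
      simp at h1 h2
      subst h1
      exact hl'.1 h2
    have hIc : ∀ (x y : V × Fin K → Bool),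
        (∀ a ∈ (({u} : Finset V) ×ˢ (Finset.univ : Finset (Fin K))), x a = y a) →
        ∀ i, In x i u ↔ In y i u := by
      intro x y h i
      have h' : ∀ j, x (u, j) = y (u, j) := fun j => h _ (by simp)
      simp [In, h']
    have hNc : ∀ t m', ∀ (x y : V × Fin K → Bool),
        (∀ a ∈ (l.toFinset ×ˢ (Finset.univ : Finset (Fin K))), x a = y a) →
        t ≤ N x m' l → t ≤ N y m' l := by
      intro t m' x y h
      rw [N_congr x y l (fun u hu j => h _ (by simpa using hu))]
      exact id
    have i1 := indep μ X hXm hX _ _ hdis (fun x => ¬ In x m u) (fun x => s+1 ≤ N x m l)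
      (fun x y h => by simp [hIc x y h]) (hNc _ _)
    have i2 := indep μ X hXm hX _ _ hdis (fun x => In x m u ∧ ¬ In x (m+1) u)
      (fun x => s ≤ N x m l) (fun x y h => by simp [hIc x y h]) (hNc _ _)
    have i3 := indep μ X hXm hX _ _ hdis (fun x => In x (m+1) u)
      (fun x => s ≤ N x (m+1) l) (fun x y h => by simp [hIc x y h]) (hNc _ _)
    have p0 := prob_In μ q hq0 X hX hXq u m hm
    have p1 := prob_In μ q hq0 X hX hXq u (m+1) hm'
    have hmeas : ∀ i, MeasurableSet {ω | In (fun a => X a ω) i u} := by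
      intro i
      have : Measurable (fun ω a => X a ω) := measurable_pi_lambda _ hXm
      exact this (t := {x | In x i u}) (Set.toFinite _).measurableSet
    have p2 : μ.real {ω | ¬ In (fun a => X a ω) m u} = 1 - q ^ m := by
      rw [← p0, ← probReal_compl_eq_one_sub (hmeas m)]; rfl
    have p3 : μ.real {ω | In (fun a => X a ω) m u ∧ ¬ In (fun a => X a ω) (m+1) u} =
        q ^ m - q ^ (m+1) := by
      have hss : {ω | In (fun a => X a ω) (m+1) u} ⊆ {ω | In (fun a => X a ω) m u} :=
        fun ω (h : In (fun a => X a ω) (m+1) u) =>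
          (In_mono (Nat.le_succ m) h : In (fun a => X a ω) m u)
      rw [← p0, ← p1, ← measureReal_sdiff hss (hmeas _)]; rfl
    have b1 := ih hl'.2 m hm (s+1)
    have b2 := ih hl'.2 m hm s
    have b3 := ih hl'.2 (m+1) hm' s
    obtain ⟨r, hr⟩ : ∃ r, K - m = r + 1 := ⟨K - m - 1, by omega⟩
    have hr' : K - (m+1) = r := by omega
    rw [hr] at b1 b2 ⊢
    rw [hr'] at b3
    have qm : q ^ m ≤ 1 := pow_le_one₀ hq0 hq1
    have qm0 : 0 ≤ q ^ m := by positivity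
    have qs : q ^ (m+1) ≤ q ^ m := pow_le_pow_of_le_one hq0 hq1 (Nat.le_succ m)
    have qs0 : 0 ≤ q ^ (m+1) := by positivity
    calc _ ≤ _ := measureReal_mono sub
      _ ≤ _ := (measureReal_union_le _ _).trans
        (add_le_add le_rfl (measureReal_union_le _ _))
      _ ≤ (1 - q^m) * F q (s+1) (r+1) + ((q^m - q^(m+1)) * F q s (r+1) + q^(m+1) * F q s r) := by
        rw [i1, i2, i3, p1, p2, p3]
        have := mul_le_mul_of_nonneg_left b1 (sub_nonneg.2 qm)
        have := mul_le_mul_of_nonneg_left b2 (sub_nonneg.2 qs)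
        have := mul_le_mul_of_nonneg_left b3 qs0
        linarith
      _ = F q (s+1) (r+1) := by simp only [F]; ring

end TB


/-- For every vertex `v` and positive integer `s`, if `Y` is a binomial
random variable with parameters `s` and `q`, then `Pr[|B̃(v)| > s] ≤ Pr[Y < k]`, where
`Pr[Y < k] = ∑_{j < k} C(s,j)·qʲ·(1−q)^{s−j}`. -/
theorem truncBunch_tail_bound
    {V : Type*} [MetricSpace V] [Fintype V] {Ω : Type*} [MeasurableSpace Ω]
    (μ : MeasureTheory.Measure Ω) [MeasureTheory.IsProbabilityMeasure μ]
    (n : ℕ) (hn : Fintype.card V = n)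
    (k : ℕ) (hk : 2 ≤ k)
    (q : ℝ) (hq0 : 0 < q) (hq1 : q < 1)
    -- the i.i.d. Bernoulli(q) sampling variables `X_{v,i}`, `v ∈ V`, `0 ≤ i ≤ k−2`
    (X : V × Fin (k - 1) → Ω → Bool)
    (hXmeas : ∀ a, Measurable (X a))
    (hXind : ProbabilityTheory.iIndepFun X μ)
    (hXq : ∀ a, μ {ω | X a ω = true} = ENNReal.ofReal q)
    -- the random nested sets `A_i = {v : X_{v,0} = ⋯ = X_{v,i−1} = true}`, `0 ≤ i ≤ k−1`
    (A : ℕ → Ω → Set V)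
    (hA : ∀ i ≤ k - 1, ∀ ω,
      A i ω = {v : V | ∀ j : Fin (k - 1), (j : ℕ) < i → X (v, j) ω = true})
    -- the random truncated bunches `B̃(v) = ⋃_{i ≤ k-2} B_i(v)`
    (Bt : V → Ω → Set V)
    (hBt : ∀ v ω, ∀ u : V, u ∈ Bt v ω ↔
      ∃ i ≤ k - 2, u ∈ A i ω ∧ ∀ w ∈ A (i + 1) ω, dist v u < dist v w)
    (v : V) (s : ℕ) (hs : 0 < s) :
    μ {ω | s < (Bt v ω).ncard} ≤
      ∑ j ∈ Finset.range k,
        ENNReal.ofReal ((s.choose j : ℝ) * q ^ j * (1 - q) ^ (s - j)) := by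
  classical
  have hq1' : 0 ≤ 1 - q := by linarith
  let le : V → V → Bool := fun a b => decide (dist v a ≤ dist v b)
  let l : List V := (Finset.univ : Finset V).toList.mergeSort le
  have hperm : l.Perm (Finset.univ : Finset V).toList := List.mergeSort_perm _ _
  have hnd : l.Nodup := hperm.nodup_iff.2 (Finset.nodup_toList _)
  have hpw : l.Pairwise (fun a b => dist v a ≤ dist v b) := by
    have := List.pairwise_mergeSort (le := le)
      (fun a b c h1 h2 => by simp only [le, decide_eq_true_eq] at *; linarith)
      (fun a b => by simp only [le, Bool.or_eq_true, decide_eq_true_eq]; exact le_total _ _)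
      (Finset.univ : Finset V).toList
    exact this.imp (fun h => by simpa [le] using h)
  have hmem : ∀ u, u ∈ l := fun u => hperm.mem_iff.2 (by simp)
  have hm := TB.main μ q hq0.le hq1.le X hXmeas hXind hXq l hnd 0 (Nat.zero_le _) s
  rw [Nat.sub_zero, TB.F_eq, show k - 1 + 1 = k by omega] at hm
  have hsub : {ω | s < (Bt v ω).ncard} ⊆ {ω | s ≤ TB.N (fun a => X a ω) 0 l} := by
    intro ω hω
    simp only [Set.mem_ofPred_eq] at hω ⊢
    have hc := TB.count_le (fun a => X a ω) (fun u => dist v u) (fun u => u ∈ Bt v ω)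
      (by
        intro u hu
        obtain ⟨i, hi, h1, h2⟩ := (hBt v ω u).1 hu
        rw [hA i (by omega)] at h1
        rw [hA (i+1) (by omega)] at h2
        exact ⟨i, by omega, h1, fun w hw => h2 w hw⟩)
      l 0 hpw (fun _ _ h => absurd h (lt_irrefl _))
    have hcard : (Bt v ω).ncard = (l.filter (fun u => u ∈ Bt v ω)).length := by
      rw [← List.toFinset_card_of_nodup (hnd.filter _), ← Set.ncard_coe_finset]
      congr 1
      ext u
      simp [hmem]
    omega
  rw [← ENNReal.ofReal_sum_of_nonneg (fun j _ => by positivity)]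
  refine (MeasureTheory.measure_mono hsub).trans ?_
  rw [← MeasureTheory.ofReal_measureReal]
  exact ENNReal.ofReal_le_ofReal hm
end

section
/- Assume 2 ≤ ℓ ≤ n and k ≤ log₂ ℓ. Then with probability at least 1 − 1/n, every vertex v ∈ V satisfies |B̃(v)| ≤ 16·ℓ^{1/k}·ln n; that is, Pr[∃ v ∈ V : |B̃(v)| > 16·ℓ^{1/k}·ln n] ≤ 1/n. -/
open scoped ENNReal

namespace TB

open MeasureTheory ProbabilityTheory

noncomputable def ht {V : Type*} {m : ℕ} (x : V × Fin m → Bool) (u : V) : ℕ :=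
  by classical exact Nat.findGreatest (fun j => ∀ i : Fin m, (i : ℕ) < j → x (u, i) = true) m

lemma ht_le {V : Type*} {m : ℕ} (x : V × Fin m → Bool) (u : V) : ht x u ≤ m := by
  classical
  exact Nat.findGreatest_le m

lemma le_ht {V : Type*} {m : ℕ} (x : V × Fin m → Bool) (u : V) (j : ℕ) (hj : j ≤ m) :
    j ≤ ht x u ↔ ∀ i : Fin m, (i : ℕ) < j → x (u, i) = true := by
  classical
  constructor
  · intro h i hi
    have := Nat.findGreatest_spec (P := fun j => ∀ i : Fin m, (i : ℕ) < j → x (u, i) = true)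
      (m := 0) (n := m) (Nat.zero_le _) (by intro i hi; omega)
    exact this i (lt_of_lt_of_le hi h)
  · intro h
    exact Nat.le_findGreatest hj h

lemma ht_congr {V : Type*} {m : ℕ} (x y : V × Fin m → Bool) (u : V)
    (h : ∀ i, x (u, i) = y (u, i)) : ht x u = ht y u := by
  unfold ht
  simp only [h]

/-- weak record count -/
noncomputable def cnt {V : Type*} {m : ℕ} (x : V × Fin m → Bool) : List V → ℕ → ℕ
  | [], _ => 0
  | a :: L, h => (if h ≤ ht x a ∧ ht x a < m then 1 else 0) + cnt x L (max h (ht x a))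

lemma cnt_congr {V : Type*} {m : ℕ} (x y : V × Fin m → Bool) (L : List V) (h : ℕ)
    (hxy : ∀ u ∈ L, ∀ i, x (u, i) = y (u, i)) : cnt x L h = cnt y L h := by
  induction L generalizing h with
  | nil => rfl
  | cons a L ih =>
    have h1 := ht_congr x y a (hxy a (by simp))
    simp only [cnt, h1]
    rw [ih]
    intro u hu
    exact hxy u (by simp [hu])

lemma rec_card {V : Type*} {m : ℕ} (x : V × Fin m → Bool) (f : V → ℝ)
    (L : List V) (hL : L.Pairwise (fun a b => f a ≤ f b)) (h : ℕ) (S : Finset V)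
    (hS : ∀ u ∈ S, u ∈ L ∧ h ≤ ht x u ∧ ht x u < m ∧ ∀ w ∈ L, f w ≤ f u → ht x w ≤ ht x u) :
    S.card ≤ cnt x L h := by
  classical
  induction L generalizing h S with
  | nil =>
    have : S = ∅ := by
      apply Finset.eq_empty_of_forall_notMem
      intro u hu
      have := (hS u hu).1
      simp at this
    simp [this]
  | cons a L ih =>
    rw [List.pairwise_cons] at hL
    have h2 : (S.erase a).card ≤ cnt x L (max h (ht x a)) := by
      apply ih hL.2
      intro u hu
      rw [Finset.mem_erase] at hu
      obtain ⟨h1, h2, h3, h4⟩ := hS u hu.2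
      have huL : u ∈ L := by
        rcases List.mem_cons.1 h1 with h | h
        · exact absurd h hu.1
        · exact h
      refine ⟨huL, max_le h2 (h4 a (by simp) (hL.1 u huL)), h3, fun w hw => h4 w (by simp [hw])⟩
    simp only [cnt]
    by_cases ha : a ∈ S
    · obtain ⟨h1, h2', h3, h4⟩ := hS a ha
      rw [if_pos ⟨h2', h3⟩]
      have := Finset.card_erase_add_one ha
      omega
    · rw [Finset.erase_eq_of_notMem ha] at h2
      omega

noncomputable def pj (q : ℝ) (m j : ℕ) : ℝ := if j < m then q ^ j - q ^ (j+1) else q ^ m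

noncomputable def wj (z : ℝ) (m h j : ℕ) : ℝ := if h ≤ j ∧ j < m then z else 1

lemma sum_aux (q z : ℝ) (hq0 : 0 ≤ q) (hz : (1 - q) * z + q / 2 ≤ 1) (d : ℕ) :
    ∑ i ∈ Finset.range d, (q ^ i - q ^ (i+1)) * z * 2 ^ (d - i) + q ^ d ≤ 2 ^ d := by
  induction d with
  | zero => simp
  | succ d ih =>
    rw [Finset.sum_range_succ']
    have : ∑ i ∈ Finset.range d, (q ^ (i+1) - q ^ (i+1+1)) * z * 2 ^ (d + 1 - (i + 1))
        = q * ∑ i ∈ Finset.range d, (q ^ i - q ^ (i+1)) * z * 2 ^ (d - i) := by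
      rw [Finset.mul_sum]
      apply Finset.sum_congr rfl
      intro i _
      rw [Nat.add_sub_add_right]
      ring
    rw [this]
    have h1 := mul_le_mul_of_nonneg_left ih hq0
    have h2 : (0:ℝ) < 2 ^ (d+1) := by positivity
    have h3 := mul_le_mul_of_nonneg_left hz h2.le
    simp only [Nat.sub_zero, pow_zero]
    have h4 : (2:ℝ)^(d+1) = 2 * 2^d := by ring
    rw [h4] at h3 ⊢
    have h5 : q^(d+1) = q * q^d := by ring
    rw [h5]
    simp only [zero_add, pow_one]
    linarith

lemma sum_main (q z : ℝ) (hq0 : 0 ≤ q) (hz : (1 - q) * z + q / 2 ≤ 1) (m h : ℕ) (hm : h ≤ m) :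
    ∑ j ∈ Finset.range (m+1), pj q m j * (wj z m h j * 2 ^ (m - max h j)) ≤ 2 ^ (m - h) := by
  obtain ⟨d, rfl⟩ := Nat.exists_eq_add_of_le hm
  rw [Finset.sum_range_succ, Finset.sum_range_add]
  have e1 : ∑ j ∈ Finset.range h, pj q (h+d) j * (wj z (h+d) h j * 2 ^ (h + d - max h j))
      = (1 - q ^ h) * 2 ^ d := by
    have : ∀ j ∈ Finset.range h, pj q (h+d) j * (wj z (h+d) h j * 2 ^ (h + d - max h j))
       = (q ^ j - q^(j+1)) * 2 ^ d := by
      intro j hj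
      rw [Finset.mem_range] at hj
      have : h + d - max h j = d := by omega
      rw [this, pj, wj, if_pos (by omega), if_neg (by omega)]
      ring
    rw [Finset.sum_congr rfl this, ← Finset.sum_mul, Finset.sum_range_sub']
    simp
  have e2 : ∑ j ∈ Finset.range d, pj q (h+d) (h+j) * (wj z (h+d) h (h+j) * 2 ^ (h + d - max h (h+j)))
      = q ^ h * ∑ i ∈ Finset.range d, (q ^ i - q ^ (i+1)) * z * 2 ^ (d - i) := by
    rw [Finset.mul_sum]
    apply Finset.sum_congr rfl
    intro j hj
    rw [Finset.mem_range] at hj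
    have : h + d - max h (h+j) = d - j := by omega
    rw [this, pj, wj, if_pos (by omega), if_pos (by omega)]
    ring
  rw [e1, e2, pj, wj, if_neg (by omega), if_neg (by omega)]
  have e3 : h + d - max h (h+d) = 0 := by omega
  have e4 : h + d - h = d := by omega
  rw [e3, e4]
  have := mul_le_mul_of_nonneg_left (sum_aux q z hq0 hz d) (pow_nonneg hq0 h)
  rw [pow_add]
  linarith

lemma meas_ge {V Ω : Type*} [MeasurableSpace Ω] (μ : Measure Ω) [IsProbabilityMeasure μ]
    {m : ℕ} (q : ℝ) (hq0 : 0 ≤ q) (X : V × Fin m → Ω → Bool)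
    (hXmeas : ∀ a, Measurable (X a))
    (hXind : iIndepFun X μ)
    (hXq : ∀ a, μ {ω | X a ω = true} = ENNReal.ofReal q) (u : V) (j : ℕ) (hj : j ≤ m) :
    μ {ω | j ≤ ht (fun a => X a ω) u} = ENNReal.ofReal (q ^ j) := by
  classical
  let S : Finset (V × Fin m) := (Finset.univ.filter (fun i : Fin m => (i:ℕ) < j)).image (fun i => (u, i))
  have hS := hXind.measure_inter_preimage_eq_mul S (sets := fun _ => {true})
    (fun _ _ => MeasurableSet.singleton _)
  have e1 : {ω | j ≤ ht (fun a => X a ω) u} = ⋂ i ∈ S, X i ⁻¹' {true} := by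
    ext ω
    simp [S, le_ht _ u j hj]
  rw [e1, hS]
  have e2 : ∀ a ∈ S, μ (X a ⁻¹' {true}) = ENNReal.ofReal q := fun a _ => hXq a
  rw [Finset.prod_congr rfl e2, Finset.prod_const, ENNReal.ofReal_pow hq0]
  congr 1
  rw [Finset.card_image_of_injective _ (fun a b h => by simpa using h), Fin.card_filter_val_lt]
  omega

lemma meas_ht {V Ω : Type*} [Fintype V] [MeasurableSpace Ω] (μ : Measure Ω) [IsProbabilityMeasure μ]
    {m : ℕ} (q : ℝ) (hq0 : 0 ≤ q) (X : V × Fin m → Ω → Bool)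
    (hXmeas : ∀ a, Measurable (X a))
    (hXind : iIndepFun X μ)
    (hXq : ∀ a, μ {ω | X a ω = true} = ENNReal.ofReal q) (u : V) (j : ℕ) (hj : j ≤ m) :
    μ {ω | ht (fun a => X a ω) u = j} = ENNReal.ofReal (pj q m j) := by
  classical
  have hX : Measurable (fun ω => (fun a => X a ω)) := measurable_pi_lambda _ hXmeas
  have hmeas : ∀ P : (V × Fin m → Bool) → Prop, MeasurableSet {ω | P (fun a => X a ω)} := by
    intro P
    exact hX (MeasurableSet.of_discrete (s := {x | P x}))
  unfold pj
  split_ifs with hjm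
  · have : {ω | ht (fun a => X a ω) u = j} =
        {ω | j ≤ ht (fun a => X a ω) u} \ {ω | j + 1 ≤ ht (fun a => X a ω) u} := by
      ext ω; simp; omega
    rw [this, measure_sdiff (by intro ω; simp; omega)
      (hmeas (fun x => j + 1 ≤ ht x u)).nullMeasurableSet (measure_ne_top _ _),
      meas_ge μ q hq0 X hXmeas hXind hXq u j hj, meas_ge μ q hq0 X hXmeas hXind hXq u (j+1) hjm,
      ENNReal.ofReal_sub _ (by positivity)]
  · obtain rfl : j = m := by omega
    rw [← meas_ge μ q hq0 X hXmeas hXind hXq u j hj]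
    congr 1
    ext ω
    have := ht_le (fun a => X a ω) u
    simp; omega

lemma mgf_bound {V Ω : Type*} [Fintype V] [MeasurableSpace Ω] (μ : Measure Ω)
    [IsProbabilityMeasure μ]
    {m : ℕ} (q z : ℝ) (hq0 : 0 ≤ q) (hq1 : q ≤ 1) (hz1 : 1 ≤ z) (hz : (1 - q) * z + q / 2 ≤ 1)
    (X : V × Fin m → Ω → Bool)
    (hXmeas : ∀ a, Measurable (X a))
    (hXind : iIndepFun X μ)
    (hXq : ∀ a, μ {ω | X a ω = true} = ENNReal.ofReal q) (L : List V) (hL : L.Nodup)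
    (h : ℕ) (hh : h ≤ m) :
    ∫⁻ ω, ENNReal.ofReal (z ^ cnt (fun a => X a ω) L h) ∂μ ≤ ENNReal.ofReal (2 ^ (m - h)) := by
  classical
  have hX : Measurable (fun ω => (fun a => X a ω)) := measurable_pi_lambda _ hXmeas
  have hmeas : ∀ P : (V × Fin m → Bool) → ℝ≥0∞, Measurable (fun ω => P (fun a => X a ω)) :=
    fun P => (Measurable.of_discrete (f := P)).comp hX
  induction L generalizing h with
  | nil =>
    simp only [cnt, pow_zero, lintegral_const, measure_univ, mul_one]
    exact ENNReal.ofReal_le_ofReal (one_le_pow₀ (by norm_num))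
  | cons u L ih =>
    rw [List.nodup_cons] at hL
    have ih := ih hL.2
    let I : ℕ → Ω → ℝ≥0∞ := fun j ω => if ht (fun a => X a ω) u = j then 1 else 0
    let F : ℕ → Ω → ℝ≥0∞ := fun j ω => ENNReal.ofReal (z ^ cnt (fun a => X a ω) L (max h j))
    have key : ∀ ω, ENNReal.ofReal (z ^ cnt (fun a => X a ω) (u :: L) h) =
        ∑ j ∈ Finset.range (m+1), ENNReal.ofReal (wj z m h j) * (I j ω * F j ω) := by
      intro ω
      rw [Finset.sum_eq_single (ht (fun a => X a ω) u)]
      · simp only [I, F, cnt, if_true, one_mul, wj]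
        rw [← ENNReal.ofReal_mul (by split_ifs <;> linarith)]
        congr 1
        split_ifs <;> ring
      · intro j _ hj
        simp [I, hj.symm]
      · intro hj
        have := ht_le (fun a => X a ω) u
        simp at hj; omega
    have hind : ∀ j, IndepFun (I j) (F j) μ := by
      intro j
      let S : Finset (V × Fin m) := Finset.univ.filter (fun a => a.1 = u)
      let T : Finset (V × Fin m) := Finset.univ.filter (fun a => a.1 ∈ L)
      have hd : Disjoint S T := by
        rw [Finset.disjoint_left]
        intro a ha hb
        simp only [S, T, Finset.mem_filter, Finset.mem_univ, true_and] at ha hb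
        exact hL.1 (ha ▸ hb)
      have h0 := hXind.indepFun_finset S T hd hXmeas
      let ext : (R : Finset (V × Fin m)) → (R → Bool) → (V × Fin m → Bool) :=
        fun R y a => if ha : a ∈ R then y ⟨a, ha⟩ else false
      have h1 := h0.comp
        (φ := fun y => if ht (ext S y) u = j then (1 : ℝ≥0∞) else 0)
        (ψ := fun y => ENNReal.ofReal (z ^ cnt (ext T y) L (max h j)))
        Measurable.of_discrete Measurable.of_discrete
      convert h1 using 1
      · funext ω
        simp only [I, Function.comp]
        rw [ht_congr (fun a => X a ω) (ext S fun i => X i ω) u]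
        intro i
        simp [ext, S]
      · funext ω
        simp only [F, Function.comp]
        rw [cnt_congr (fun a => X a ω) (ext T fun i => X i ω) L]
        intro v hv i
        simp [ext, T, hv]
    have hIm : ∀ j, Measurable (I j) := fun j => hmeas (fun x => if ht x u = j then 1 else 0)
    have hFm : ∀ j, Measurable (F j) :=
      fun j => hmeas (fun x => ENNReal.ofReal (z ^ cnt x L (max h j)))
    have hIint : ∀ j ≤ m, ∫⁻ ω, I j ω ∂μ = ENNReal.ofReal (pj q m j) := by
      intro j hj
      rw [← meas_ht μ q hq0 X hXmeas hXind hXq u j hj, ← lintegral_indicator_one]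
      · apply lintegral_congr
        intro ω
        simp [I, Set.indicator_apply]
      · exact hX (MeasurableSet.of_discrete (s := {x | ht x u = j}))
    have hp : ∀ j, 0 ≤ pj q m j := by
      intro j
      unfold pj
      split_ifs
      · have := pow_le_pow_of_le_one hq0 hq1 (Nat.le_succ j)
        simp at this; linarith
      · positivity
    have hw : ∀ j, 0 ≤ wj z m h j := by
      intro j; unfold wj; split_ifs <;> linarith
    calc ∫⁻ ω, ENNReal.ofReal (z ^ cnt (fun a => X a ω) (u :: L) h) ∂μ
        = ∑ j ∈ Finset.range (m+1), ENNReal.ofReal (wj z m h j) * ((∫⁻ ω, I j ω ∂μ) * ∫⁻ ω, F j ω ∂μ) := by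
          simp_rw [key]
          rw [lintegral_finsetSum]
          · apply Finset.sum_congr rfl
            intro j _
            rw [lintegral_const_mul (f := fun a => I j a * F j a) _ ((hIm j).mul (hFm j))]
            congr 1
            exact lintegral_mul_eq_lintegral_mul_lintegral_of_indepFun (hIm j) (hFm j) (hind j)
          · intro j _
            exact ((hIm j).mul (hFm j)).const_mul _
      _ ≤ ∑ j ∈ Finset.range (m+1), ENNReal.ofReal (pj q m j * (wj z m h j * 2 ^ (m - max h j))) := by
          apply Finset.sum_le_sum
          intro j hj
          rw [Finset.mem_range] at hj
          rw [hIint j (by omega), ENNReal.ofReal_mul (hp j), ENNReal.ofReal_mul (hw j),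
            mul_left_comm]
          gcongr
          exact ih (max h j) (by omega)
      _ = ENNReal.ofReal (∑ j ∈ Finset.range (m+1), pj q m j * (wj z m h j * 2 ^ (m - max h j))) := by
          rw [ENNReal.ofReal_sum_of_nonneg]
          intro j _
          have := hp j
          have := hw j
          positivity
      _ ≤ _ := ENNReal.ofReal_le_ofReal (sum_main q z hq0 hz m h hh)

end TB

/-- Assume `2 ≤ ℓ ≤ n` and `k ≤ log₂ ℓ`. Then with probability at least
`1 − 1/n`, every vertex `v` satisfies `|B̃(v)| ≤ 16·ℓ^{1/k}·ln n`. -/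
theorem truncBunch_whp_bound
    {V : Type*} [MetricSpace V] [Fintype V] {Ω : Type*} [MeasurableSpace Ω]
    (μ : MeasureTheory.Measure Ω) [MeasureTheory.IsProbabilityMeasure μ]
    (n : ℕ) (hn : Fintype.card V = n)
    (k : ℕ) (hk : 2 ≤ k)
    (hn2 : 2 ≤ n)
    (ℓ : ℕ) (hℓ : 2 ≤ ℓ) (hℓn : ℓ ≤ n)
    (hkℓ : (k : ℝ) ≤ Real.logb 2 ℓ)
    (q : ℝ) (hq : q = (ℓ : ℝ) ^ (-(1 : ℝ) / k))
    -- the i.i.d. Bernoulli(q) sampling variables `X_{v,i}`, `v ∈ V`, `0 ≤ i ≤ k−2`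
    (X : V × Fin (k - 1) → Ω → Bool)
    (hXmeas : ∀ a, Measurable (X a))
    (hXind : ProbabilityTheory.iIndepFun X μ)
    (hXq : ∀ a, μ {ω | X a ω = true} = ENNReal.ofReal q)
    -- the random nested sets `A_i = {v : X_{v,0} = ⋯ = X_{v,i−1} = true}`, `0 ≤ i ≤ k−1`
    (A : ℕ → Ω → Set V)
    (hA : ∀ i ≤ k - 1, ∀ ω,
      A i ω = {v : V | ∀ j : Fin (k - 1), (j : ℕ) < i → X (v, j) ω = true})
    -- the random truncated bunches `B̃(v) = ⋃_{i ≤ k-2} B_i(v)`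
    (Bt : V → Ω → Set V)
    (hBt : ∀ v ω, ∀ u : V, u ∈ Bt v ω ↔
      ∃ i ≤ k - 2, u ∈ A i ω ∧ ∀ w ∈ A (i + 1) ω, dist v u < dist v w)
 :
    μ {ω | ∃ v : V,
        16 * (ℓ : ℝ) ^ ((1 : ℝ) / k) * Real.log n < ((Bt v ω).ncard : ℝ)} ≤
      ((n : ℝ≥0∞))⁻¹ := by
  classical
  have hk0 : (0:ℝ) < k := by positivity
  have hℓ0 : (0:ℝ) < ℓ := by positivity
  have hn0 : (0:ℝ) < n := by positivity
  have h2k : (2:ℝ) ^ k ≤ ℓ := by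
    have := (Real.le_logb_iff_rpow_le (by norm_num) hℓ0).1 hkℓ
    rwa [Real.rpow_natCast] at this
  have hq0 : 0 < q := by rw [hq]; positivity
  have hqi : (ℓ : ℝ) ^ ((1 : ℝ) / k) * q = 1 := by
    rw [hq, ← Real.rpow_add hℓ0]
    have : (1:ℝ) / k + -1 / k = 0 := by ring
    rw [this, Real.rpow_zero]
  have hq1 : q ≤ 1 := by
    rw [hq]
    apply Real.rpow_le_one_of_one_le_of_nonpos
    · exact_mod_cast (by omega : 1 ≤ ℓ)
    · rw [neg_div]; simp
  have hlog : 0 < Real.log n := Real.log_pos (by exact_mod_cast (by omega : 1 < n))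
  set z : ℝ := (1 - q/2)⁻¹ with hzdef
  have hd : 0 < 1 - q/2 := by linarith
  have hz1 : 1 ≤ z := (one_le_inv₀ hd).2 (by linarith)
  have hz : (1 - q) * z + q / 2 ≤ 1 := by
    have : (1 - q) * z ≤ 1 - q/2 := by
      rw [hzdef, ← div_eq_mul_inv, div_le_iff₀ hd]
      nlinarith [sq_nonneg q]
    linarith
  have hze : Real.exp (q/2) ≤ z := by
    rw [hzdef, le_inv_comm₀ (Real.exp_pos _) hd, ← Real.exp_neg]
    have := Real.add_one_le_exp (-(q/2))
    linarith
  let f : V → V → ℝ := fun v u => dist v u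
  have hsort : ∀ v : V, ∃ L : List V, L.Nodup ∧ (∀ u, u ∈ L) ∧
      L.Pairwise (fun a b => f v a ≤ f v b) := by
    intro v
    let r : V → V → Prop := fun a b => f v a ≤ f v b
    have : Std.Total r := ⟨fun a b => le_total _ _⟩
    have : IsTrans V r := ⟨fun a b c h1 h2 => le_trans h1 h2⟩
    refine ⟨(Finset.univ : Finset V).toList.insertionSort r, ?_, ?_, ?_⟩
    · exact (List.perm_insertionSort r _).nodup_iff.2 (Finset.nodup_toList _)
    · intro u
      rw [(List.perm_insertionSort r _).mem_iff]
      simp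
    · exact List.pairwise_insertionSort r _
  choose L hLn hLm hLs using hsort
  have hdet : ∀ v ω, (Bt v ω).ncard ≤ TB.cnt (fun a => X a ω) (L v) 0 := by
    intro v ω
    rw [Set.ncard_eq_toFinset_card']
    apply TB.rec_card _ (f v) (L v) (hLs v)
    intro u hu
    rw [Set.mem_toFinset, hBt] at hu
    obtain ⟨i, hi, hu1, hu2⟩ := hu
    rw [hA i (by omega)] at hu1
    rw [hA (i+1) (by omega)] at hu2
    have a1 : i ≤ TB.ht (fun a => X a ω) u := (TB.le_ht _ u i (by omega)).2 hu1
    have a2 : ∀ w, f v w ≤ f v u → TB.ht (fun a => X a ω) w ≤ i := by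
      intro w hw
      by_contra hc
      exact absurd (hu2 w ((TB.le_ht (fun a => X a ω) w (i+1) (by omega)).1 (by omega)))
        (not_lt.2 hw)
    have a3 := a2 u le_rfl
    exact ⟨hLm v u, Nat.zero_le _, by omega, fun w _ hw => (a2 w hw).trans a1⟩
  have hX : Measurable (fun ω => (fun a => X a ω)) := measurable_pi_lambda _ hXmeas
  have hone : ∀ v, μ {ω | 16 * (ℓ : ℝ) ^ ((1 : ℝ) / k) * Real.log n < ((Bt v ω).ncard : ℝ)} ≤
      ENNReal.ofReal ((n:ℝ)⁻¹ * (n:ℝ)⁻¹) := by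
    intro v
    have hsub : {ω | 16 * (ℓ : ℝ) ^ ((1 : ℝ) / k) * Real.log n < ((Bt v ω).ncard : ℝ)} ⊆
        {ω | ENNReal.ofReal ((n:ℝ)^8) ≤ ENNReal.ofReal (z ^ TB.cnt (fun a => X a ω) (L v) 0)} := by
      intro ω hω
      simp only [Set.mem_ofPred_eq] at hω ⊢
      apply ENNReal.ofReal_le_ofReal
      have h1 : ((Bt v ω).ncard : ℝ) ≤ (TB.cnt (fun a => X a ω) (L v) 0 : ℝ) := by
        exact_mod_cast hdet v ω
      set c := TB.cnt (fun a => X a ω) (L v) 0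
      have h2 : 8 * Real.log n ≤ c * (q/2) := by
        have h3 := mul_le_mul_of_nonneg_right (hω.le.trans h1) (by positivity : 0 ≤ q/2)
        have h4 : 16 * (ℓ : ℝ) ^ ((1 : ℝ) / k) * Real.log n * (q/2)
          = 8 * Real.log n * ((ℓ : ℝ) ^ ((1 : ℝ) / k) * q) := by ring
        rw [h4, hqi] at h3
        linarith
      calc (n:ℝ)^8 = Real.exp (8 * Real.log n) := by
            have := Real.exp_nat_mul (Real.log n) 8
            rw [Real.exp_log hn0] at this
            rw [← this]; norm_num
        _ ≤ Real.exp (c * (q/2)) := Real.exp_le_exp.2 h2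
        _ = Real.exp (q/2) ^ c := Real.exp_nat_mul _ _
        _ ≤ z ^ c := by gcongr
    refine (MeasureTheory.measure_mono hsub).trans ?_
    have hn8 : (0:ℝ) < (n:ℝ)^8 := by positivity
    have hmk := MeasureTheory.meas_ge_le_lintegral_div (μ := μ)
      (f := fun ω => ENNReal.ofReal (z ^ TB.cnt (fun a => X a ω) (L v) 0))
      (((Measurable.of_discrete
        (f := fun x => ENNReal.ofReal (z ^ TB.cnt x (L v) 0))).comp hX).aemeasurable)
      (ε := ENNReal.ofReal ((n:ℝ)^8)) (by simpa using (by omega : n ≠ 0)) ENNReal.ofReal_ne_top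
    refine hmk.trans ?_
    have hb := TB.mgf_bound μ q z hq0.le hq1 hz1 hz X hXmeas hXind hXq (L v) (hLn v) 0
      (Nat.zero_le _)
    refine (ENNReal.div_le_div_right hb _).trans ?_
    rw [← ENNReal.ofReal_div_of_pos hn8]
    apply ENNReal.ofReal_le_ofReal
    rw [div_le_iff₀ hn8]
    have h1n : (1:ℝ) ≤ n := by exact_mod_cast (by omega : 1 ≤ n)
    calc (2:ℝ) ^ (k - 1 - 0) ≤ 2 ^ k := pow_le_pow_right₀ (by norm_num) (by omega)
      _ ≤ ℓ := h2k
      _ ≤ n := by exact_mod_cast hℓn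
      _ = (n:ℝ)^1 := by ring
      _ ≤ (n:ℝ)^6 := pow_le_pow_right₀ h1n (by norm_num)
      _ = (n:ℝ)⁻¹ * (n:ℝ)⁻¹ * (n:ℝ)^8 := by field_simp
  have hun : {ω | ∃ v : V,
        16 * (ℓ : ℝ) ^ ((1 : ℝ) / k) * Real.log n < ((Bt v ω).ncard : ℝ)} =
      ⋃ v ∈ (Finset.univ : Finset V),
        {ω | 16 * (ℓ : ℝ) ^ ((1 : ℝ) / k) * Real.log n < ((Bt v ω).ncard : ℝ)} := by
    ext ω; simp
  rw [hun]
  refine (MeasureTheory.measure_biUnion_finset_le _ _).trans ?_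
  refine (Finset.sum_le_sum (fun v _ => hone v)).trans ?_
  rw [Finset.sum_const, Finset.card_univ, hn, nsmul_eq_mul, ← ENNReal.ofReal_natCast n,
    ← ENNReal.ofReal_mul (by positivity), ← ENNReal.ofReal_inv_of_pos hn0]
  apply ENNReal.ofReal_le_ofReal
  rw [← mul_assoc, mul_inv_cancel₀ hn0.ne', one_mul]
end
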